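/- arXiv:1003.2439 — 2 statements merged into one kernel-verified Lean document; each statement's English description precedes it below -/
import Mathlib

section
/- (Theorem 1, case s ≥ 3 with ‖γ‖ > 0, via the Gaussian representation.) Let s ≥ 3 be an integer, b, γ ∈ ℝ^s with 0 < ‖b‖ < 1 and ‖γ‖ > 0, let ψ = (bᵀγ)/(‖b‖‖γ‖), let κ > 0, ℓ > 0, and let m be a positive integer. On a probability space let ξ = (ξ₁,…,ξ_s) have independent standard normal N(0,1) coordinates, let ζ ∼ N(0,1), and let W be a nonnegative random variable, with ξ, ζ, W mutually independent and W having Lebesgue density f_W(w) = (2 (m/2)^{m/2} / Γ(m/2)) w^{m−1} e^{−m w²/2} for w > 0 (and 0 otherwise). Define G = Σᵢ bᵢξᵢ + √(1−‖b‖²) ζ and H = γ + ξ. Then P( −κW ≤ G ≤ κW and HᵀH > sℓW² ) = ∫₀¹ ∫₀¹ ∫₀^∞ ∫₀^{u(t₁,r)} i( −‖b‖ r k(t₁,t₂), w ) f_W(w) f_R(r) f_{T₁}(t₁) f_{T₂}(t₂) dw dr dt₁ dt₂, where f_R(r) = (2^{1−s/2}/Γ(s/2)) r^{s−1} e^{−r²/2}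 for r > 0 (and 0 otherwise), f_{T₁}(t₁) = (π / B(1/2,(s−1)/2)) sin^{s−2}(π t₁) on [0,1], f_{T₂}(t₂) = (π / B(1/2,(s−2)/2)) sin^{s−3}(π t₂) on [0,1], k(t₁,t₂) = ψ cos(πt₁) + √(1−ψ²) sin(πt₁) cos(2πt₂) if s = 3 and k(t₁,t₂) = ψ cos(πt₁) + √(1−ψ²) sin(πt₁) cos(πt₂) if s ≥ 4, u(t₁, r) = √( (‖γ‖² + 2‖γ‖ r cos(πt₁) + r²) / (sℓ) ), and i(x, w) = P( −κw + x ≤ Z ≤ κw + x ) for Z ∼ N(0, 1 − ‖b‖²). -/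
open MeasureTheory ProbabilityTheory Real
open scoped InnerProductSpace

lemma aux_gauss1 (F : ℝ → ENNReal) (hF : Measurable F) :
    ∫⁻ x, F x ∂(gaussianReal 0 1)
      = ∫⁻ x, F x * ENNReal.ofReal ((√(2 * π))⁻¹ * rexp (-x ^ 2 / 2)) := by
  rw [gaussianReal_of_var_ne_zero 0 one_ne_zero,
    lintegral_withDensity_eq_lintegral_mul _ (measurable_gaussianPDF 0 1) hF]
  refine lintegral_congr fun x => ?_
  simp [gaussianPDF, gaussianPDFReal, mul_comm]

lemma aux_gauss_pi (n : ℕ) (F : (Fin n → ℝ) → ENNReal) (hF : Measurable F) :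
    ∫⁻ x, F x ∂(Measure.pi fun _ : Fin n => gaussianReal 0 1)
      = ∫⁻ x, F x * ENNReal.ofReal ((√(2 * π))⁻¹ ^ n * rexp (-(∑ i, x i ^ 2) / 2)) := by
  induction n with
  | zero =>
    rw [Measure.pi_of_empty _ (0 : Fin 0 → ℝ), volume_pi, Measure.pi_of_empty _ (0 : Fin 0 → ℝ)]
    simp [lintegral_dirac' _ hF]
  | succ n ih =>
    have h1 := (measurePreserving_piFinSuccAbove (fun _ : Fin (n+1) => gaussianReal 0 1) 0).symm
    have h2 := (volume_preserving_piFinSuccAbove (fun _ : Fin (n+1) => ℝ) 0).symm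
    rw [← h1.lintegral_comp hF, ← h2.lintegral_comp (by fun_prop)]
    rw [lintegral_prod _ (by fun_prop), Measure.volume_eq_prod, lintegral_prod _ (by fun_prop)]
    rw [aux_gauss1 _ (by
      apply Measurable.lintegral_prod_right'
        (f := fun z => F ((MeasurableEquiv.piFinSuccAbove (fun _ : Fin (n+1) => ℝ) 0).symm z))
      fun_prop)]
    refine lintegral_congr fun x => ?_
    rw [ih _ (by fun_prop), ← lintegral_mul_const _ (by fun_prop)]
    refine lintegral_congr fun y => ?_
    rw [mul_assoc, ← ENNReal.ofReal_mul (by positivity)]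
    congr 2
    simp only [MeasurableEquiv.piFinSuccAbove_symm_apply, Fin.insertNthEquiv_zero, Fin.consEquiv_apply]
    rw [Fin.sum_univ_succ]
    simp only [Fin.cons_zero, Fin.cons_succ]
    rw [mul_mul_mul_comm, ← Real.exp_add, pow_succ]
    congr 2
    ring

lemma aux_radial (n : ℕ) (g : ℝ → ENNReal) (hg : Measurable g) :
    ∫⁻ x : EuclideanSpace ℝ (Fin (n+1)), g ‖x‖
      = ENNReal.ofReal ((n+1) * (√π ^ (n+1) / Gamma (((n+1 : ℕ):ℝ) / 2 + 1))) *
        ∫⁻ y in Set.Ioi (0:ℝ), ENNReal.ofReal (y ^ n) * g y := by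
  have hfr : Module.finrank ℝ (EuclideanSpace ℝ (Fin (n+1))) = n + 1 := by simp
  set μ : Measure (EuclideanSpace ℝ (Fin (n+1))) := volume with hμ
  calc ∫⁻ x, g ‖x‖ ∂μ
    _ = ∫⁻ x : ({(0)}ᶜ : Set (EuclideanSpace ℝ (Fin (n+1)))), g (‖x.1‖) ∂(μ.comap (↑)) := by
      rw [lintegral_subtype_comap (measurableSet_singleton _).compl fun x ↦ g (‖x‖),
        restrict_compl_singleton]
    _ = ∫⁻ x, g x.2 ∂μ.toSphere.prod (.volumeIoiPow n) := by
      have := μ.measurePreserving_homeomorphUnitSphereProd.lintegral_comp_emb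
        (Homeomorph.measurableEmbedding _) (g ∘ Subtype.val ∘ Prod.snd)
      simpa using this
    _ = μ.toSphere Set.univ * ∫⁻ x : Set.Ioi (0 : ℝ), g x ∂.volumeIoiPow n := by
      rw [lintegral_prod _ (by fun_prop)]
      simp [mul_comm]
    _ = _ := by
      rw [Measure.toSphere_apply_univ, hfr, hμ, EuclideanSpace.volume_ball]
      simp only [Measure.volumeIoiPow]
      rw [lintegral_withDensity_eq_lintegral_mul _ (by fun_prop) (by fun_prop)]
      simp only [Pi.mul_apply]
      rw [lintegral_subtype_comap measurableSet_Ioi (fun y => ENNReal.ofReal (y ^ n) * g y)]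
      congr 1
      rw [ENNReal.ofReal_mul (by positivity)]
      have : ENNReal.ofReal ((n:ℝ)+1) = (n:ENNReal)+1 := by
        rw [← Nat.cast_succ, ENNReal.ofReal_natCast]; simp
      simp [this]

lemma aux_chi (n : ℕ) (g : ℝ → ENNReal) (hg : Measurable g) :
    ∫⁻ x, g (∑ i, x i ^ 2) ∂(Measure.pi fun _ : Fin (n+1) => gaussianReal 0 1)
      = ENNReal.ofReal ((√(2 * π))⁻¹ ^ (n+1) * ((n+1) * (√π ^ (n+1) / Gamma (((n+1 : ℕ):ℝ) / 2 + 1)))) *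
        ∫⁻ y in Set.Ioi (0:ℝ), ENNReal.ofReal (y ^ n) * ENNReal.ofReal (rexp (-y^2/2)) * g (y^2) := by
  rw [aux_gauss_pi _ _ (by fun_prop)]
  rw [← (PiLp.volume_preserving_ofLp (Fin (n+1))).lintegral_comp (by fun_prop)]
  have h := aux_radial n (fun r => g (r^2) * ENNReal.ofReal ((√(2 * π))⁻¹ ^ (n+1) * rexp (-r^2/2))) (by fun_prop)
  have h' : ∀ x : EuclideanSpace ℝ (Fin (n+1)), ∑ i, (WithLp.ofLp x) i ^ 2 = ‖x‖^2 := fun x => by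
    rw [EuclideanSpace.norm_sq_eq]; simp
  simp only [h']
  rw [h, mul_comm (_ ^ _), ENNReal.ofReal_mul (q := (√(2 * π))⁻¹ ^ (n+1)) (by positivity), mul_assoc]
  congr 1
  rw [← lintegral_const_mul _ (by fun_prop)]
  refine lintegral_congr fun y => ?_
  rw [ENNReal.ofReal_mul (by positivity)]
  ring

lemma aux_polar (F : ℝ → ℝ → ENNReal) (hF : Measurable (Function.uncurry F)) :
    ∫⁻ x, ∫⁻ y in Set.Ioi (0:ℝ), F x y
      = ∫⁻ r in Set.Ioi (0:ℝ), ∫⁻ θ in Set.Ioo 0 π, ENNReal.ofReal r * F (r * cos θ) (r * sin θ) := by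
  set G : ℝ × ℝ → ENNReal := fun p => (Set.Ioi (0:ℝ)).indicator (F p.1) p.2 with hG
  have hG' : G = (Prod.snd ⁻¹' (Set.Ioi (0:ℝ))).indicator (Function.uncurry F) := by
    ext p; simp [hG, Set.indicator, Function.uncurry]
  have hGm : Measurable G := by
    rw [hG']; exact hF.indicator (measurable_snd measurableSet_Ioi)
  have h := lintegral_comp_polarCoord_symm G
  rw [Measure.volume_eq_prod, lintegral_prod _ (by fun_prop)] at h
  have e1 : ∫⁻ x, ∫⁻ y in Set.Ioi (0:ℝ), F x y = ∫⁻ x, ∫⁻ y, G (x, y) := by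
    refine lintegral_congr fun x => ?_
    rw [← lintegral_indicator measurableSet_Ioi]
  rw [e1, ← h, polarCoord_target, ← Measure.prod_restrict, lintegral_prod]
  · refine setLIntegral_congr_fun measurableSet_Ioi fun r hr => ?_
    simp only [polarCoord_symm_apply, smul_eq_mul]
    rw [← lintegral_indicator measurableSet_Ioo, ← lintegral_indicator measurableSet_Ioo]
    refine lintegral_congr fun θ => ?_
    have hr : 0 < r := hr
    by_cases h1 : θ ∈ Set.Ioo 0 π
    · have h2 : θ ∈ Set.Ioo (-π) π := ⟨by linarith [h1.1, pi_pos], h1.2⟩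
      have : r * sin θ ∈ Set.Ioi 0 := mul_pos hr (sin_pos_of_mem_Ioo h1)
      rw [Set.indicator_of_mem h1, Set.indicator_of_mem h2]
      simp only [hG]
      rw [Set.indicator_of_mem this]
    · rw [Set.indicator_of_notMem h1]
      by_cases h2 : θ ∈ Set.Ioo (-π) π
      · rw [Set.indicator_of_mem h2]
        have h3 : θ ≤ 0 := by
          by_contra h3; exact h1 ⟨by linarith, h2.2⟩
        have : r * sin θ ∉ Set.Ioi 0 := by
          rw [Set.mem_Ioi]
          have := sin_nonpos_of_nonpos_of_neg_pi_le h3 h2.1.le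
          nlinarith
        simp only [hG]
        rw [Set.indicator_of_notMem this, mul_zero]
      · rw [Set.indicator_of_notMem h2]
  · have := hGm.comp continuous_polarCoord_symm.measurable
    apply Measurable.aemeasurable
    simp only [smul_eq_mul]
    exact (by fun_prop : Measurable fun p : ℝ × ℝ => ENNReal.ofReal p.1).mul this

lemma aux_swap3 {α β δ : Type*} [MeasurableSpace α] [MeasurableSpace β] [MeasurableSpace δ]
    (μ : Measure α) (ν : Measure β) (ρ : Measure δ) [SFinite μ] [SFinite ν] [SFinite ρ]
    (K : α × β × δ → ENNReal) (hK : Measurable K) :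
    ∫⁻ a, ∫⁻ b, ∫⁻ c, K (a, b, c) ∂ρ ∂ν ∂μ = ∫⁻ c, ∫⁻ b, ∫⁻ a, K (a, b, c) ∂μ ∂ν ∂ρ := by
  calc _ = ∫⁻ b, ∫⁻ a, ∫⁻ c, K (a, b, c) ∂ρ ∂μ ∂ν := by
        rw [lintegral_lintegral_swap]
        exact (Measurable.lintegral_prod_right'
          (f := fun p : (α × β) × δ => K (p.1.1, p.1.2, p.2)) (by fun_prop)).aemeasurable
    _ = ∫⁻ b, ∫⁻ c, ∫⁻ a, K (a, b, c) ∂μ ∂ρ ∂ν := by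
        refine lintegral_congr fun b => ?_
        rw [lintegral_lintegral_swap]
        exact Measurable.aemeasurable (by unfold Function.uncurry; fun_prop)
    _ = _ := by
        rw [lintegral_lintegral_swap]
        exact (Measurable.lintegral_prod_right'
          (f := fun p : (β × δ) × α => K (p.2, p.1.1, p.1.2)) (by fun_prop)).aemeasurable

lemma aux_gauss_split (n : ℕ) (F : ℝ × (Fin n → ℝ) → ENNReal) (hF : Measurable F) :
    ∫⁻ x, F (x 0, fun i => x i.succ) ∂(Measure.pi fun _ : Fin (n+1) => gaussianReal 0 1)
     = ∫⁻ x, ∫⁻ y, F (x, y) ∂(Measure.pi fun _ : Fin n => gaussianReal 0 1) ∂(gaussianReal 0 1) := by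
  have h1 := (measurePreserving_piFinSuccAbove (fun _ : Fin (n+1) => gaussianReal 0 1) 0)
  rw [← lintegral_prod _ hF.aemeasurable, ← h1.lintegral_comp hF]
  rfl

noncomputable def auxC (n : ℕ) : ℝ :=
  (√(2 * π))⁻¹ ^ 2 * ((√(2 * π))⁻¹ ^ (n+1) * ((n+1) * (√π ^ (n+1) / Gamma (((n+1 : ℕ):ℝ) / 2 + 1))))

lemma aux_spherical (n : ℕ) (f : ℝ × ℝ × ℝ → ENNReal) (hf : Measurable f) :
    ∫⁻ x, f (x 0, x 1, ∑ i, x i ^ 2) ∂(Measure.pi fun _ : Fin (n+3) => gaussianReal 0 1)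
      = ∫⁻ θ in Set.Ioo 0 π, ∫⁻ φ in Set.Ioo 0 π, ∫⁻ r in Set.Ioi (0:ℝ),
          ENNReal.ofReal (auxC n * r ^ (n+2) * sin φ ^ (n+1) * sin θ ^ n * rexp (-r^2/2))
            * f (r * cos φ, r * sin φ * cos θ, r ^ 2) := by
  set C : ℝ := (√(2 * π))⁻¹ ^ (n+1) * ((n+1) * (√π ^ (n+1) / Gamma (((n+1 : ℕ):ℝ) / 2 + 1))) with hC
  have hC0 : 0 ≤ C := by positivity
  set e : ℝ → ENNReal := fun x => ENNReal.ofReal ((√(2 * π))⁻¹ * rexp (-x ^ 2 / 2)) with he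
  have hem : Measurable e := by fun_prop
  set K : ℝ × ℝ × ℝ → ENNReal := fun p => 
    ENNReal.ofReal C * (ENNReal.ofReal (p.2.2 ^ n) * ENNReal.ofReal (rexp (-p.2.2^2/2)) * 
      f (p.1, p.2.1, p.1^2 + (p.2.1^2 + p.2.2^2))) * e p.2.1 * e p.1 with hK
  have hKm : Measurable K := by fun_prop
  have s1 : ∫⁻ x, f (x 0, x 1, ∑ i, x i ^ 2) ∂(Measure.pi fun _ : Fin (n+3) => gaussianReal 0 1)
      = ∫⁻ x, ∫⁻ y, ∫⁻ ρ in Set.Ioi (0:ℝ), K (x, y, ρ) := by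
    have t1 := aux_gauss_split (n+2) (fun p => f (p.1, p.2 0, p.1^2 + ∑ i, p.2 i ^ 2)) (by fun_prop)
    simp only at t1
    have t0 : ∀ x : Fin (n+3) → ℝ, f (x 0, x 1, ∑ i, x i ^ 2) =
        f (x 0, x (Fin.succ 0), x 0 ^ 2 + ∑ i : Fin (n+2), x i.succ ^ 2) := by
      intro x
      rw [Fin.sum_univ_succ]; rfl
    simp only [t0]
    rw [t1, aux_gauss1 _ (by
      apply Measurable.lintegral_prod_right' 
        (f := fun p : ℝ × (Fin (n+2) → ℝ) => f (p.1, p.2 0, p.1^2 + ∑ i, p.2 i ^ 2))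
      fun_prop)]
    refine lintegral_congr fun x => ?_
    have t2 := aux_gauss_split (n+1) (fun p => f (x, p.1, x^2 + (p.1^2 + ∑ i, p.2 i ^ 2))) (by fun_prop)
    simp only at t2
    simp only [Fin.sum_univ_succ (n := n+1)]
    rw [t2, aux_gauss1 _ (by
      apply Measurable.lintegral_prod_right' 
        (f := fun p : ℝ × (Fin (n+1) → ℝ) => f (x, p.1, x^2 + (p.1^2 + ∑ i, p.2 i ^ 2)))
      fun_prop), ← lintegral_mul_const]
    swap
    · refine Measurable.mul ?_ (by fun_prop)
      apply Measurable.lintegral_prod_right' 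
        (f := fun p : ℝ × (Fin (n+1) → ℝ) => f (x, p.1, x^2 + (p.1^2 + ∑ i, p.2 i ^ 2)))
      fun_prop
    refine lintegral_congr fun y => ?_
    rw [aux_chi n (fun q => f (x, y, x^2 + (y^2 + q))) (by fun_prop),
      ← lintegral_const_mul _ (by fun_prop), ← lintegral_mul_const _ (by fun_prop),
      ← lintegral_mul_const _ (by fun_prop)]
  rw [s1]
  have s2 : ∫⁻ x, ∫⁻ y, ∫⁻ ρ in Set.Ioi (0:ℝ), K (x, y, ρ)
      = ∫⁻ x, ∫⁻ q in Set.Ioi (0:ℝ), ∫⁻ θ in Set.Ioo 0 π,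
          ENNReal.ofReal q * K (x, q * cos θ, q * sin θ) := by
    refine lintegral_congr fun x => ?_
    exact aux_polar (fun y ρ => K (x, y, ρ)) (by unfold Function.uncurry; fun_prop)
  rw [s2, aux_polar (fun x q => ∫⁻ θ in Set.Ioo 0 π,
          ENNReal.ofReal q * K (x, q * cos θ, q * sin θ)) (by
      unfold Function.uncurry
      exact Measurable.lintegral_prod_right'
        (f := fun p : (ℝ × ℝ) × ℝ => ENNReal.ofReal p.1.2 * K (p.1.1, p.1.2 * cos p.2, p.1.2 * sin p.2))
        (by fun_prop))]
  have s3 : ∀ r φ : ℝ, ENNReal.ofReal r * ∫⁻ θ in Set.Ioo 0 π, ENNReal.ofReal (r * sin φ) *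
        K (r * cos φ, r * sin φ * cos θ, r * sin φ * sin θ) =
        ∫⁻ θ in Set.Ioo 0 π, ENNReal.ofReal r * (ENNReal.ofReal (r * sin φ) *
        K (r * cos φ, r * sin φ * cos θ, r * sin φ * sin θ)) := by
    intro r φ
    rw [← lintegral_const_mul _ (by fun_prop)]
  simp only [s3]
  rw [aux_swap3 _ _ _ (fun p : ℝ × ℝ × ℝ => ENNReal.ofReal p.1 * (ENNReal.ofReal (p.1 * sin p.2.1) *
        K (p.1 * cos p.2.1, p.1 * sin p.2.1 * cos p.2.2, p.1 * sin p.2.1 * sin p.2.2))) (by fun_prop)]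
  refine setLIntegral_congr_fun measurableSet_Ioo fun θ hθ => ?_
  refine setLIntegral_congr_fun measurableSet_Ioo fun φ hφ => ?_
  refine setLIntegral_congr_fun measurableSet_Ioi fun r hr => ?_
  have hr : 0 < r := hr
  have h1 : 0 < sin θ := sin_pos_of_mem_Ioo hθ
  have h2 : 0 < sin φ := sin_pos_of_mem_Ioo hφ
  simp only [hK, he]
  have e1 : (r * cos φ)^2 + ((r * sin φ * cos θ)^2 + (r * sin φ * sin θ)^2) = r^2 := by
    have a1 := sin_sq_add_cos_sq θ
    have a2 := sin_sq_add_cos_sq φ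
    linear_combination r^2 * sin φ^2 * a1 + r^2 * a2
  rw [e1]
  have e2 : auxC n * r ^ (n+2) * sin φ ^ (n+1) * sin θ ^ n * rexp (-r^2/2) =
     r * ((r * sin φ) * (C * ((r * sin φ * sin θ)^n * rexp (-(r * sin φ * sin θ)^2/2)) *
       ((√(2 * π))⁻¹ * rexp (-(r * sin φ * cos θ)^2/2)) * ((√(2 * π))⁻¹ * rexp (-(r * cos φ)^2/2)))) := by
    have : -r^2/2 = -(r * sin φ * sin θ)^2/2 + (-(r * sin φ * cos θ)^2/2 + (-(r * cos φ)^2/2)) := by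
      rw [← e1]; ring
    rw [this, Real.exp_add, Real.exp_add, auxC, ← hC]
    ring
  have e3 : ∀ a b c d g h k : ℝ, 0 ≤ a → 0 ≤ b → 0 ≤ c → 0 ≤ d → 0 ≤ g → 0 ≤ h → 0 ≤ k →
      ENNReal.ofReal (a * (b * (c * (d * g) * h * k))) = ENNReal.ofReal a * (ENNReal.ofReal b *
        (ENNReal.ofReal c * (ENNReal.ofReal d * ENNReal.ofReal g) * ENNReal.ofReal h
          * ENNReal.ofReal k)) := by
    intro a b c d g h k ha hb hc hd hg hh hk
    rw [ENNReal.ofReal_mul ha, ENNReal.ofReal_mul hb, ENNReal.ofReal_mul (by positivity),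
      ENNReal.ofReal_mul (by positivity), ENNReal.ofReal_mul hc, ENNReal.ofReal_mul hd]
  rw [e2, e3 _ _ _ _ _ _ _ hr.le (by positivity) hC0 (by positivity) (by positivity) (by positivity)
    (by positivity)]
  clear_value C
  ring

lemma aux_const (n : ℕ) :
    auxC n * π * π = (2 : ℝ) ^ (1 - ((n + 3 : ℕ) : ℝ) / 2) / Gamma (((n + 3 : ℕ) : ℝ) / 2) *
      (π / (Gamma (1 / 2) * Gamma ((((n + 3 : ℕ) : ℝ) - 1) / 2)
            / Gamma (1 / 2 + (((n + 3 : ℕ) : ℝ) - 1) / 2))) *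
      (π / (Gamma (1 / 2) * Gamma ((((n + 3 : ℕ) : ℝ) - 2) / 2)
            / Gamma (1 / 2 + (((n + 3 : ℕ) : ℝ) - 2) / 2))) := by
  have e1 : (1:ℝ) / 2 + (((n + 3 : ℕ) : ℝ) - 1) / 2 = ((n + 3 : ℕ) : ℝ) / 2 := by ring
  have e2 : (1:ℝ) / 2 + (((n + 3 : ℕ) : ℝ) - 2) / 2 = (((n + 3 : ℕ) : ℝ) - 1) / 2 := by ring
  have e3 : (((n + 3 : ℕ) : ℝ) - 2) / 2 = ((n+1 : ℕ):ℝ) / 2 := by push_cast; ring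
  have g1 : Gamma (((n + 3 : ℕ) : ℝ) / 2) ≠ 0 := (Gamma_pos_of_pos (by positivity)).ne'
  have g2 : Gamma ((((n + 3 : ℕ) : ℝ) - 1) / 2) ≠ 0 :=
    (Gamma_pos_of_pos (by push_cast; linarith [(n.cast_nonneg : (0:ℝ) ≤ n)])).ne'
  have g3 : Gamma (((n + 1 : ℕ) : ℝ) / 2) ≠ 0 := (Gamma_pos_of_pos (by positivity)).ne'
  have e4 : Gamma (((n+1 : ℕ):ℝ) / 2 + 1) = ((n:ℝ)+1) / 2 * Gamma (((n + 1 : ℕ) : ℝ) / 2) := by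
    rw [Gamma_add_one (by positivity)]; push_cast; ring
  have e5 : (2 : ℝ) ^ (1 - ((n + 3 : ℕ) : ℝ) / 2) = 2 * (√2)⁻¹ ^ (n+3) := by
    rw [Real.rpow_sub two_pos, Real.rpow_one, inv_pow, Real.sqrt_eq_rpow, ← Real.rpow_natCast,
      ← Real.rpow_mul two_pos.le, div_eq_mul_inv]
    congr 3
    ring
  have e6 : √(2 * π) = √2 * √π := Real.sqrt_mul two_pos.le _
  have hp : π = √π ^ 2 := (Real.sq_sqrt pi_pos.le).symm
  have hp0 : √π ≠ 0 := by positivity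
  have h20 : √2 ≠ 0 := by positivity
  rw [auxC, e1, e2, e3, e4, e5, e6, Gamma_one_half_eq]
  generalize Gamma (((n + 3 : ℕ) : ℝ) / 2) = A at *
  generalize Gamma ((((n + 3 : ℕ) : ℝ) - 1) / 2) = B at *
  generalize Gamma (((n + 1 : ℕ) : ℝ) / 2) = D at *
  have hn : (n:ℝ) + 1 ≠ 0 := by positivity
  generalize √2 = x at *
  generalize hy : √π = y at *
  rw [hp]
  field_simp
  rw [one_div, one_div, inv_pow, inv_pow, mul_pow]
  field_simp
  ring

lemma aux_scale (g : ℝ → ENNReal) :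
    ∫⁻ θ in Set.Ioo 0 π, g θ = ∫⁻ t in Set.Icc (0:ℝ) 1, ENNReal.ofReal π * g (π * t) := by
  rw [setLIntegral_congr Ioo_ae_eq_Icc.symm]
  have h := lintegral_image_eq_lintegral_abs_deriv_mul (s := Set.Ioo (0:ℝ) 1)
    (f := fun t => π * t) (f' := fun _ => π) measurableSet_Ioo
    (fun x _ => by simpa using ((hasDerivAt_id x).const_mul π).hasDerivWithinAt)
    (fun x _ y _ hxy => by simpa [pi_ne_zero] using hxy) g
  rw [Set.image_mul_left_Ioo pi_pos] at h
  simpa [abs_of_pos pi_pos] using h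

lemma aux_double (h : ℝ → ENNReal) :
    ∫⁻ t in Set.Icc (0:ℝ) 1, h (cos (2 * π * t)) = ∫⁻ t in Set.Icc (0:ℝ) 1, h (cos (π * t)) := by
  have h1 := lintegral_image_eq_lintegral_abs_deriv_mul (s := Set.Ioc (0:ℝ) 1)
    (f := fun t => (1/2) * t) (f' := fun _ => 1/2) measurableSet_Ioc
    (fun x _ => by simpa using ((hasDerivAt_id x).const_mul (1/2:ℝ)).hasDerivWithinAt)
    (fun x _ y _ hxy => by simpa using hxy) (fun t => h (cos (2 * π * t)))
  have h2 := lintegral_image_eq_lintegral_abs_deriv_mul (s := Set.Ico (0:ℝ) 1)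
    (f := fun t => 1 - (1/2) * t) (f' := fun _ => -(1/2)) measurableSet_Ico
    (fun x _ => by simpa using (((hasDerivAt_id x).const_mul (1/2:ℝ)).const_sub 1).hasDerivWithinAt)
    (fun x _ y _ hxy => by simpa using hxy) (fun t => h (cos (2 * π * t)))
  have i1 : (fun t : ℝ => (1/2) * t) '' Set.Ioc (0:ℝ) 1 = Set.Ioc 0 (1/2) := by
    rw [Set.image_mul_left_Ioc (by norm_num)]; norm_num
  have i2 : (fun t : ℝ => 1 - (1/2) * t) '' Set.Ico (0:ℝ) 1 = Set.Ioc (1/2) 1 := by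
    ext t
    simp only [Set.mem_image, Set.mem_Ico, Set.mem_Ioc]
    constructor
    · rintro ⟨x, ⟨hx, hx'⟩, rfl⟩; constructor <;> linarith
    · rintro ⟨hx, hx'⟩; exact ⟨2 - 2 * t, ⟨by linarith, by linarith⟩, by ring⟩
  have c1 : ∀ t, cos (2 * π * (1 / 2 * t)) = cos (π * t) := fun t => by ring_nf
  have c2 : ∀ t, cos (2 * π * (1 - 1 / 2 * t)) = cos (π * t) := fun t => by
    rw [← cos_two_pi_sub]; ring_nf
  rw [i1] at h1
  rw [i2] at h2
  simp only [c1] at h1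
  simp only [c2] at h2
  rw [setLIntegral_congr Ioc_ae_eq_Icc.symm, setLIntegral_congr (Ioc_ae_eq_Icc (a := (0:ℝ)) (b := 1)).symm,
    ← Set.Ioc_union_Ioc_eq_Ioc (show (0:ℝ) ≤ 1/2 by norm_num) (show (1/2:ℝ) ≤ 1 by norm_num),
    lintegral_union measurableSet_Ioc (Set.Ioc_disjoint_Ioc_of_le le_rfl), h1, h2,
    Set.Ioc_union_Ioc_eq_Ioc (show (0:ℝ) ≤ 1/2 by norm_num) (show (1/2:ℝ) ≤ 1 by norm_num),
    setLIntegral_congr (Ico_ae_eq_Ioc (a := (0:ℝ)) (b := 1)), abs_neg,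
    lintegral_const_mul' _ _ ENNReal.ofReal_ne_top, ← add_mul, ← ENNReal.ofReal_add (by positivity) (by positivity)]
  norm_num

lemma aux_spherical2 (n : ℕ) (f : ℝ × ℝ × ℝ → ENNReal) (hf : Measurable f) (d : ℝ → ℝ)
    (hd : d = fun t => if n + 3 = 3 then cos (2 * π * t) else cos (π * t)) (cR c1 c2 : ℝ)
    (hcR : 0 ≤ cR) (hc1 : 0 ≤ c1) (hc2 : 0 ≤ c2) (hc : auxC n * π * π = cR * c1 * c2) :
    ∫⁻ x, f (x 0, x 1, ∑ i, x i ^ 2) ∂(Measure.pi fun _ : Fin (n+3) => gaussianReal 0 1)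
      = ∫⁻ t₂ in Set.Icc (0:ℝ) 1, ∫⁻ t₁ in Set.Icc (0:ℝ) 1, ∫⁻ r in Set.Ioi (0:ℝ),
          f (r * cos (π * t₁), r * sin (π * t₁) * d t₂, r ^ 2) *
          ENNReal.ofReal (cR * r ^ (n+2) * rexp (-r^2/2)) * 
          ENNReal.ofReal (c1 * sin (π * t₁) ^ (n+1)) * ENNReal.ofReal (c2 * sin (π * t₂) ^ n) := by
  have hsin : ∀ t ∈ Set.Icc (0:ℝ) 1, 0 ≤ sin (π * t) := fun t ht =>
    sin_nonneg_of_nonneg_of_le_pi (mul_nonneg pi_pos.le ht.1)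
      (by nlinarith [ht.2, pi_pos])
  rw [aux_spherical n f hf]
  simp only [aux_scale]
  have key : ∀ t₂ ∈ Set.Icc (0:ℝ) 1, ENNReal.ofReal π * ∫⁻ t₁ in Set.Icc (0:ℝ) 1, ENNReal.ofReal π *
      ∫⁻ r in Set.Ioi (0:ℝ), ENNReal.ofReal (auxC n * r ^ (n+2) * sin (π * t₁) ^ (n+1)
        * sin (π * t₂) ^ n * rexp (-r^2/2))
            * f (r * cos (π * t₁), r * sin (π * t₁) * cos (π * t₂), r ^ 2) =
      ∫⁻ t₁ in Set.Icc (0:ℝ) 1, ∫⁻ r in Set.Ioi (0:ℝ),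
          f (r * cos (π * t₁), r * sin (π * t₁) * cos (π * t₂), r ^ 2) *
          ENNReal.ofReal (cR * r ^ (n+2) * rexp (-r^2/2)) * 
          ENNReal.ofReal (c1 * sin (π * t₁) ^ (n+1)) * ENNReal.ofReal (c2 * sin (π * t₂) ^ n) := by
    intro t₂ ht₂
    rw [← lintegral_const_mul' _ _ ENNReal.ofReal_ne_top]
    refine setLIntegral_congr_fun measurableSet_Icc fun t₁ ht₁ => ?_
    beta_reduce
    rw [← lintegral_const_mul' _ _ ENNReal.ofReal_ne_top, ← lintegral_const_mul' _ _ ENNReal.ofReal_ne_top]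
    refine setLIntegral_congr_fun measurableSet_Ioi fun r hr => ?_
    have hr : 0 < r := hr
    have h1 := hsin _ ht₁
    have h2 := hsin _ ht₂
    beta_reduce
    generalize f (r * cos (π * t₁), r * sin (π * t₁) * cos (π * t₂), r ^ 2) = Y
    rw [← mul_assoc, ← mul_assoc, ← ENNReal.ofReal_mul pi_pos.le, ← ENNReal.ofReal_mul (by positivity),
      mul_comm, mul_assoc Y, mul_assoc Y, ← ENNReal.ofReal_mul (by positivity), ← ENNReal.ofReal_mul (by positivity)]
    congr 2
    linear_combination (r ^ (n+2) * sin (π * t₁) ^ (n+1)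
        * sin (π * t₂) ^ n * rexp (-r^2/2)) * hc
  rw [setLIntegral_congr_fun measurableSet_Icc key]
  rcases Nat.eq_zero_or_pos n with rfl | hn
  · subst hd
    simp only [zero_add, if_true, pow_zero]
    exact (aux_double (fun c => ∫⁻ t₁ in Set.Icc (0:ℝ) 1, ∫⁻ r in Set.Ioi (0:ℝ),
          f (r * cos (π * t₁), r * sin (π * t₁) * c, r ^ 2) *
          ENNReal.ofReal (cR * r ^ 2 * rexp (-r^2/2)) * 
          ENNReal.ofReal (c1 * sin (π * t₁) ^ 1) * ENNReal.ofReal (c2 * 1))).symm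
  · have : ¬ (n + 3 = 3) := by omega
    subst hd
    simp only [this, if_false]

lemma aux_basis (n : ℕ) (b γ : EuclideanSpace ℝ (Fin (n+3))) (hb : 0 < ‖b‖) (hγ : 0 < ‖γ‖)
    (ψ : ℝ) (hψ : ψ = ⟪b, γ⟫_ℝ / (‖b‖ * ‖γ‖)) :
    ∃ e : OrthonormalBasis (Fin (n+3)) ℝ (EuclideanSpace ℝ (Fin (n+3))),
      γ = ‖γ‖ • e 0 ∧ b = (‖b‖ * ψ) • e 0 + (‖b‖ * √(1 - ψ^2)) • e 1 := by
  obtain ⟨a, ha⟩ : ∃ a, a = ‖γ‖⁻¹ • γ := ⟨_, rfl⟩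
  have ha1 : ‖a‖ = 1 := by rw [ha, norm_smul]; simp [hγ.ne']
  have hcard : Module.finrank ℝ (EuclideanSpace ℝ (Fin (n+3))) = Fintype.card (Fin (n+3)) := by simp
  have hext : ∀ c : EuclideanSpace ℝ (Fin (n+3)), ‖c‖ = 1 → ⟪a, c⟫_ℝ = 0 →
      ∃ e : OrthonormalBasis (Fin (n+3)) ℝ (EuclideanSpace ℝ (Fin (n+3))), e 0 = a ∧ e 1 = c := by
    intro c hc hac
    set v : Fin (n+3) → EuclideanSpace ℝ (Fin (n+3)) := fun i => if i = 0 then a else c with hv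
    have ho : Orthonormal ℝ (Set.domRestrict {0, 1} v) := by
      constructor
      · rintro ⟨i, hi⟩
        rcases hi with rfl | hi
        · simp [hv, ha1, Set.domRestrict_apply]
        · rw [Set.mem_singleton_iff] at hi; subst hi; simp [hv, hc, Set.domRestrict_apply]
      · rintro ⟨i, hi⟩ ⟨j, hj⟩ hij
        rcases hi with rfl | hi <;> rcases hj with rfl | hj
        · simp at hij
        · rw [Set.mem_singleton_iff] at hj; subst hj; simp [hv, hac, Set.domRestrict_apply]
        · rw [Set.mem_singleton_iff] at hi; subst hi; simp [hv, real_inner_comm, hac, Set.domRestrict_apply]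
        · rw [Set.mem_singleton_iff] at hi hj; subst hi; subst hj; simp at hij
    obtain ⟨e, he⟩ := ho.exists_orthonormalBasis_extension_of_card_eq hcard
    exact ⟨e, by rw [he 0 (by simp)]; simp [hv], by rw [he 1 (by simp)]; simp [hv]⟩
  have hγa : γ = ‖γ‖ • a := by rw [ha, smul_smul, mul_inv_cancel₀ hγ.ne', one_smul]
  obtain ⟨d, hd⟩ : ∃ d, d = ‖b‖⁻¹ • b - ψ • a := ⟨_, rfl⟩
  have hbd : b = (‖b‖ * ψ) • a + ‖b‖ • d := by
    rw [hd, smul_sub, smul_smul, smul_smul, mul_inv_cancel₀ hb.ne', one_smul]; abel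
  have hba : ⟪‖b‖⁻¹ • b, a⟫_ℝ = ψ := by
    rw [ha, inner_smul_left, inner_smul_right, hψ]; simp; field_simp
  have haa : ⟪a, a⟫_ℝ = 1 := by rw [real_inner_self_eq_norm_sq, ha1]; norm_num
  have had : ⟪a, d⟫_ℝ = 0 := by
    rw [hd, inner_sub_right, inner_smul_right _ _ ψ, haa, real_inner_comm, hba]; ring
  have hdd : ‖d‖ ^ 2 = 1 - ψ ^ 2 := by
    rw [← real_inner_self_eq_norm_sq]
    nth_rw 1 [hd]
    rw [inner_sub_left, inner_smul_left _ _ ψ, had, hd, inner_sub_right, inner_smul_right _ _ ψ, hba,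
      real_inner_self_eq_norm_sq, norm_smul]
    simp [hb.ne']; ring
  have hdn : ‖d‖ = √(1 - ψ^2) := by rw [← hdd, Real.sqrt_sq (norm_nonneg _)]
  by_cases h0 : d = 0
  · have ho : Orthonormal ℝ (Set.domRestrict {(0 : Fin (n+3))} (fun _ => a)) := by
      constructor
      · rintro ⟨i, hi⟩; simp [ha1, Set.domRestrict_apply]
      · rintro ⟨i, hi⟩ ⟨j, hj⟩ hij
        rw [Set.mem_singleton_iff] at hi hj; subst hi; subst hj; simp at hij
    obtain ⟨e, he⟩ := ho.exists_orthonormalBasis_extension_of_card_eq hcard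
    have he0 : e 0 = a := he 0 (by simp)
    refine ⟨e, by rw [he0]; exact hγa, ?_⟩
    rw [← hdn, he0, h0]
    rw [h0] at hbd
    simpa using hbd
  · have hdp : 0 < ‖d‖ := norm_pos_iff.mpr h0
    obtain ⟨e, he0, he1⟩ := hext (‖d‖⁻¹ • d) (by rw [norm_smul]; simp [hdp.ne'])
      (by rw [inner_smul_right, had, mul_zero])
    refine ⟨e, by rw [he0]; exact hγa, ?_⟩
    rw [he0, he1, ← hdn, smul_smul, mul_assoc ‖b‖ ‖d‖, mul_inv_cancel₀ hdp.ne', mul_one]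
    exact hbd

lemma aux_bochner3 {α β δ : Type*} [MeasurableSpace α] [MeasurableSpace β] [MeasurableSpace δ]
    (μ : Measure α) (ν : Measure β) (ρ : Measure δ) [SFinite μ] [SFinite ν] [SFinite ρ]
    (M : α × β × δ → ENNReal) (hM : Measurable M)
    (hfin : ∫⁻ a, ∫⁻ b, ∫⁻ c, M (a, b, c) ∂ρ ∂ν ∂μ ≠ ⊤) :
    ∫ a, ∫ b, ∫ c, (M (a, b, c)).toReal ∂ρ ∂ν ∂μ
      = (∫⁻ a, ∫⁻ b, ∫⁻ c, M (a, b, c) ∂ρ ∂ν ∂μ).toReal := by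
  have m2 : Measurable fun p : α × β => ∫⁻ c, M (p.1, p.2, c) ∂ρ :=
    Measurable.lintegral_prod_right' (f := fun p : (α × β) × δ => M (p.1.1, p.1.2, p.2)) (by fun_prop)
  have m1 : Measurable fun a => ∫⁻ b, ∫⁻ c, M (a, b, c) ∂ρ ∂ν :=
    Measurable.lintegral_prod_right' (f := fun p : α × β => ∫⁻ c, M (p.1, p.2, c) ∂ρ) m2
  have f1 := ae_lt_top m1 hfin
  rw [← integral_toReal m1.aemeasurable f1]
  refine integral_congr_ae ?_
  filter_upwards [f1] with a ha
  have m3 : Measurable fun b => ∫⁻ c, M (a, b, c) ∂ρ := m2.comp (by fun_prop : Measurable fun b : β => (a, b))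
  have f2 := ae_lt_top m3 ha.ne
  rw [← integral_toReal m3.aemeasurable f2]
  refine integral_congr_ae ?_
  filter_upwards [f2] with b hb
  have m4 : Measurable fun c => M (a, b, c) := by fun_prop
  exact integral_toReal m4.aemeasurable (ae_lt_top m4 hb.ne)

lemma aux_and {α : Type*} [MeasurableSpace α] {p q : α → Prop} (hp : MeasurableSet {x | p x})
    (hq : MeasurableSet {x | q x}) : MeasurableSet {x | p x ∧ q x} := hp.inter hq

lemma aux_I_meas (v : NNReal) (κ : ℝ) : Measurable fun p : ℝ × ℝ =>
    gaussianReal 0 v (Set.Icc (-(κ * p.2) + p.1) (κ * p.2 + p.1)) := by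
  have hs : MeasurableSet {q : (ℝ × ℝ) × ℝ | -(κ * q.1.2) + q.1.1 ≤ q.2 ∧ q.2 ≤ κ * q.1.2 + q.1.1} :=
    aux_and (measurableSet_le (by fun_prop) (by fun_prop)) (measurableSet_le (by fun_prop) (by fun_prop))
  exact measurable_measure_prodMk_left (ν := gaussianReal 0 v) hs

lemma aux_prob {Ω : Type*} [MeasureSpace Ω] [IsProbabilityMeasure (ℙ : Measure Ω)]
    {E : Type*} [MeasurableSpace E] (ξ : Ω → E) (ζ W : Ω → ℝ)
    (hξm : Measurable ξ) (hζm : Measurable ζ) (hWm : Measurable W)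
    (hζ : Measure.map ζ ℙ = gaussianReal 0 1)
    (hIndep1 : IndepFun ξ ζ ℙ)
    (hIndep2 : IndepFun (fun ω => (ξ ω, ζ ω)) W ℙ)
    (L Q : E → ℝ) (hL : Measurable L) (hQ : Measurable Q) (κ c σ : ℝ) (v : NNReal)
    (hv : (gaussianReal 0 1).map (σ * ·) = gaussianReal 0 v) :
    ℙ {ω | (-(κ * W ω) ≤ L (ξ ω) + σ * ζ ω ∧ L (ξ ω) + σ * ζ ω ≤ κ * W ω) ∧
        Q (ξ ω) > c * (W ω) ^ 2} =
      ∫⁻ x, ∫⁻ w, (if c * w ^ 2 < Q x then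
        gaussianReal 0 v (Set.Icc (-(κ * w) + -(L x)) (κ * w + -(L x))) else 0)
          ∂(Measure.map W ℙ) ∂(Measure.map ξ ℙ) := by
  set S : Set ((E × ℝ) × ℝ) := {q | (-(κ * q.2) ≤ L q.1.1 + σ * q.1.2 ∧
    L q.1.1 + σ * q.1.2 ≤ κ * q.2) ∧ c * q.2 ^ 2 < Q q.1.1} with hS
  have hSm : MeasurableSet S :=
    aux_and (aux_and (measurableSet_le (by fun_prop) (by fun_prop))
      (measurableSet_le (by fun_prop) (by fun_prop)))
      (measurableSet_lt (by fun_prop) (by fun_prop))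
  have hpW := Measure.isProbabilityMeasure_map (μ := (ℙ : Measure Ω)) hWm.aemeasurable
  have hpξ := Measure.isProbabilityMeasure_map (μ := (ℙ : Measure Ω)) hξm.aemeasurable
  have hlaw : Measure.map (fun ω => ((ξ ω, ζ ω), W ω)) ℙ
      = ((Measure.map ξ ℙ).prod (gaussianReal 0 1)).prod (Measure.map W ℙ) := by
    rw [(indepFun_iff_map_prod_eq_prod_map_map (by fun_prop) (by fun_prop)).mp hIndep2,
      (indepFun_iff_map_prod_eq_prod_map_map (by fun_prop) (by fun_prop)).mp hIndep1, hζ]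
  have h1 : ℙ {ω | (-(κ * W ω) ≤ L (ξ ω) + σ * ζ ω ∧ L (ξ ω) + σ * ζ ω ≤ κ * W ω) ∧
        Q (ξ ω) > c * (W ω) ^ 2} = Measure.map (fun ω => ((ξ ω, ζ ω), W ω)) ℙ S := by
    rw [Measure.map_apply (by fun_prop) hSm]; rfl
  rw [h1, hlaw, ← lintegral_indicator_one hSm]
  have hm : Measurable (S.indicator (1 : (E × ℝ) × ℝ → ENNReal)) := measurable_one.indicator hSm
  rw [lintegral_prod _ hm.aemeasurable, lintegral_prod _ (Measurable.lintegral_prod_right' hm).aemeasurable]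
  refine lintegral_congr fun x => ?_
  rw [lintegral_lintegral_swap (by
    apply Measurable.aemeasurable
    unfold Function.uncurry
    exact hm.comp (by fun_prop : Measurable fun p : ℝ × ℝ => ((x, p.1), p.2)))]
  refine lintegral_congr fun w => ?_
  have h2 : MeasurableSet ((fun z : ℝ => ((x, z), w)) ⁻¹' S) :=
    (by fun_prop : Measurable fun z : ℝ => ((x, z), w)) hSm
  have h3 : ∫⁻ z, S.indicator 1 ((x, z), w) ∂(gaussianReal 0 1)
      = gaussianReal 0 1 ((fun z : ℝ => ((x, z), w)) ⁻¹' S) := by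
    rw [← lintegral_indicator_one h2]; rfl
  rw [h3]
  split_ifs with h
  · rw [← hv, Measure.map_apply (by fun_prop) measurableSet_Icc]
    congr 1
    ext z
    simp only [hS, Set.mem_preimage, Set.mem_ofPred_eq, Set.mem_Icc]
    constructor
    · rintro ⟨⟨a, b⟩, -⟩; constructor <;> linarith
    · rintro ⟨a, b⟩; exact ⟨⟨by linarith, by linarith⟩, h⟩
  · have : ((fun z : ℝ => ((x, z), w)) ⁻¹' S) = ∅ := by
      ext z
      simp only [hS, Set.mem_preimage, Set.mem_ofPred_eq, Set.mem_empty_iff_false, iff_false]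
      rintro ⟨-, b⟩; exact h b
    rw [this, measure_empty]

lemma aux_w (fW : ℝ → ℝ) (hfW : Measurable fW) (h0 : ∀ w ≤ 0, fW w = 0) (J : ℝ → ENNReal)
    (hJ : Measurable J) (c q : ℝ) (hc : 0 < c) :
    ∫⁻ w, (if c * w ^ 2 < q then J w else 0) ∂(volume.withDensity fun w => ENNReal.ofReal (fW w))
      = ∫⁻ w in Set.Ioc 0 (√(q / c)), J w * ENNReal.ofReal (fW w) := by
  rw [lintegral_withDensity_eq_lintegral_mul _ (by fun_prop)
    (Measurable.ite (measurableSet_lt (by fun_prop) (by fun_prop)) hJ measurable_const),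
    setLIntegral_congr Ioo_ae_eq_Ioc.symm, ← lintegral_indicator measurableSet_Ioo]
  refine lintegral_congr fun w => ?_
  simp only [Pi.mul_apply]
  by_cases hw : w ≤ 0
  · rw [Set.indicator_of_notMem (fun h => absurd h.1 (not_lt.mpr hw)), h0 w hw]; simp
  · push Not at hw
    have : c * w ^ 2 < q ↔ w < √(q / c) := by
      rw [Real.lt_sqrt hw.le, lt_div_iff₀ hc, mul_comm]
    by_cases h : w < √(q / c)
    · rw [if_pos (this.mpr h), Set.indicator_of_mem (show w ∈ Set.Ioo 0 (√(q / c)) from ⟨hw, h⟩), mul_comm]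
    · rw [if_neg (fun h' => h (this.mp h')), Set.indicator_of_notMem (fun h' => h h'.2), mul_zero]

/-- Theorem 1, case `s ≥ 3` with `‖γ‖ > 0`, via the Gaussian
representation: with `G = Σᵢ bᵢξᵢ + √(1−‖b‖²)ζ`, `H = γ + ξ` built from a
standard Gaussian vector `ξ` and a standard normal `ζ`, mutually independent of
each other and of `W` (whose density is that of `Σ̂/σ`, i.e. `mW² ~ χ²_m`),
`P(−κW ≤ G ≤ κW, HᵀH > sℓW²)` equals the quadruple integral
`∫₀¹ ∫₀¹ ∫₀^∞ ∫₀^{u(t₁,r)} i(−‖b‖ r k(t₁,t₂), w) f_W(w) f_R(r) f_{T₁}(t₁)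
f_{T₂}(t₂) dw dr dt₁ dt₂`. -/
theorem stmt18 {Ω : Type*} [MeasureSpace Ω] [IsProbabilityMeasure (ℙ : Measure Ω)]
    (s : ℕ) (hs : 3 ≤ s)
    (b γ : EuclideanSpace ℝ (Fin s))
    (hb0 : 0 < ‖b‖) (hb1 : ‖b‖ < 1) (hγ : 0 < ‖γ‖)
    (ψ : ℝ) (hψ : ψ = ⟪b, γ⟫_ℝ / (‖b‖ * ‖γ‖))
    (κ ℓ : ℝ) (hκ : 0 < κ) (hℓ : 0 < ℓ) (m : ℕ) (hm : 0 < m)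
    (ξ : Ω → EuclideanSpace ℝ (Fin s)) (ζ W : Ω → ℝ)
    (hξm : Measurable ξ) (hζm : Measurable ζ) (hWm : Measurable W)
    (hξ : Measure.map ξ ℙ
      = Measure.map (⇑(EuclideanSpace.equiv (Fin s) ℝ).symm)
          (Measure.pi fun _ : Fin s => gaussianReal 0 1))
    (hζ : Measure.map ζ ℙ = gaussianReal 0 1)
    (hIndep1 : IndepFun ξ ζ ℙ)
    (hIndep2 : IndepFun (fun ω => (ξ ω, ζ ω)) W ℙ)
    (hWnn : ∀ ω, 0 ≤ W ω)
    (fW : ℝ → ℝ)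
    (hfW : fW = fun w => if 0 < w then
        2 * ((m : ℝ) / 2) ^ ((m : ℝ) / 2) / Gamma ((m : ℝ) / 2) * w ^ (m - 1)
          * Real.exp (-(m : ℝ) * w ^ 2 / 2)
      else 0)
    (hW : Measure.map W ℙ = volume.withDensity fun w => ENNReal.ofReal (fW w))
    (G : Ω → ℝ)
    (hG : G = fun ω => (∑ i, b i * ξ ω i) + Real.sqrt (1 - ‖b‖ ^ 2) * ζ ω)
    (H : Ω → Fin s → ℝ)
    (hH : H = fun ω i => γ i + ξ ω i)
    (fR : ℝ → ℝ)
    (hfR : fR = fun r => if 0 < r then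
        (2 : ℝ) ^ (1 - (s : ℝ) / 2) / Gamma ((s : ℝ) / 2) * r ^ (s - 1)
          * Real.exp (-r ^ 2 / 2)
      else 0)
    (fT₁ : ℝ → ℝ)
    (hfT₁ : fT₁ = fun t₁ =>
      π / (Gamma (1 / 2) * Gamma (((s : ℝ) - 1) / 2)
            / Gamma (1 / 2 + ((s : ℝ) - 1) / 2))
        * Real.sin (π * t₁) ^ (s - 2))
    (fT₂ : ℝ → ℝ)
    (hfT₂ : fT₂ = fun t₂ =>
      π / (Gamma (1 / 2) * Gamma (((s : ℝ) - 2) / 2)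
            / Gamma (1 / 2 + ((s : ℝ) - 2) / 2))
        * Real.sin (π * t₂) ^ (s - 3))
    (k : ℝ → ℝ → ℝ)
    (hk : k = fun t₁ t₂ =>
      if s = 3 then
        ψ * Real.cos (π * t₁)
          + Real.sqrt (1 - ψ ^ 2) * Real.sin (π * t₁) * Real.cos (2 * π * t₂)
      else
        ψ * Real.cos (π * t₁)
          + Real.sqrt (1 - ψ ^ 2) * Real.sin (π * t₁) * Real.cos (π * t₂))
    (u : ℝ → ℝ → ℝ)
    (hu : u = fun t₁ r => Real.sqrt
      ((‖γ‖ ^ 2 + 2 * ‖γ‖ * r * Real.cos (π * t₁) + r ^ 2) / ((s : ℝ) * ℓ)))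
    (iFun : ℝ → ℝ → ℝ)
    (hiFun : iFun = fun x w =>
      (gaussianReal 0 (Real.toNNReal (1 - ‖b‖ ^ 2))
        (Set.Icc (-(κ * w) + x) (κ * w + x))).toReal) :
    (ℙ {ω | (-(κ * W ω) ≤ G ω ∧ G ω ≤ κ * W ω) ∧
        (∑ i, (H ω i) ^ 2) > (s : ℝ) * ℓ * (W ω) ^ 2}).toReal
      = ∫ t₂ in Set.Icc (0 : ℝ) 1, ∫ t₁ in Set.Icc (0 : ℝ) 1,
          ∫ r in Set.Ioi (0 : ℝ), ∫ w in Set.Ioc (0 : ℝ) (u t₁ r),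
            iFun (-(‖b‖ * r * k t₁ t₂)) w * fW w * fR r * fT₁ t₁ * fT₂ t₂ := by
  obtain ⟨n, rfl⟩ := Nat.exists_eq_add_of_le' hs
  obtain ⟨e, heγ, heb⟩ := aux_basis n b γ hb0 hγ ψ hψ
  have hb2 : 0 < 1 - ‖b‖ ^ 2 := by nlinarith
  set v := Real.toNNReal (1 - ‖b‖ ^ 2) with hvdef
  have hv : (gaussianReal 0 1).map (√(1 - ‖b‖ ^ 2) * ·) = gaussianReal 0 v := by
    rw [gaussianReal_map_const_mul]
    congr 1
    · simp
    · rw [mul_one]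
      ext
      simp only [hvdef, NNReal.coe_mk, Real.coe_toNNReal _ hb2.le]
      exact Real.sq_sqrt hb2.le
  set c : ℝ := ((n + 3 : ℕ) : ℝ) * ℓ with hc
  have hc0 : 0 < c := by positivity
  set I : ℝ × ℝ → ENNReal := fun p =>
    gaussianReal 0 v (Set.Icc (-(κ * p.2) + p.1) (κ * p.2 + p.1)) with hI
  have hIm : Measurable I := aux_I_meas v κ
  have hIfin : ∀ p, I p ≠ ⊤ := fun p => measure_ne_top _ _
  have hfWm : Measurable fW := by
    rw [hfW]
    exact Measurable.ite measurableSet_Ioi (by fun_prop) measurable_const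
  have hfW0 : ∀ w ≤ 0, fW w = 0 := fun w hw => by rw [hfW]; simp [not_lt.mpr hw]
  have hfWnn : ∀ w, 0 ≤ fW w := fun w => by
    rw [hfW]
    beta_reduce
    split_ifs with h
    · have : 0 < Gamma ((m : ℝ) / 2) := Gamma_pos_of_pos (by positivity)
      positivity
    · exact le_rfl
  set f : ℝ × ℝ × ℝ → ENNReal := fun p =>
    ∫⁻ w in Set.Ioc 0 (√((‖γ‖ ^ 2 + 2 * ‖γ‖ * p.1 + p.2.2) / c)),
      I (-(‖b‖ * (ψ * p.1 + √(1 - ψ ^ 2) * p.2.1)), w) * ENNReal.ofReal (fW w) with hf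
  have hfm : Measurable f := by
    have hS : MeasurableSet {q : (ℝ × ℝ × ℝ) × ℝ |
        0 < q.2 ∧ q.2 ≤ √((‖γ‖ ^ 2 + 2 * ‖γ‖ * q.1.1 + q.1.2.2) / c)} :=
      aux_and (measurableSet_lt (by fun_prop) (by fun_prop))
        (measurableSet_le (by fun_prop) (by fun_prop))
    have hg : Measurable fun q : (ℝ × ℝ × ℝ) × ℝ =>
        I (-(‖b‖ * (ψ * q.1.1 + √(1 - ψ ^ 2) * q.1.2.1)), q.2) * ENNReal.ofReal (fW q.2) := by
      fun_prop
    have := Measurable.lintegral_prod_right' (ν := (volume : Measure ℝ)) (hg.indicator hS)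
    convert this using 2 with p
    rw [hf]
    beta_reduce
    rw [← lintegral_indicator measurableSet_Ioc]
    rfl
  have hpi : ℙ {ω | (-(κ * W ω) ≤ G ω ∧ G ω ≤ κ * W ω) ∧
        (∑ i, (H ω i) ^ 2) > c * (W ω) ^ 2}
      = ∫⁻ x, f (x 0, x 1, ∑ i, x i ^ 2) ∂(Measure.pi fun _ : Fin (n+3) => gaussianReal 0 1) := by
    have hlaw : Measure.map ξ ℙ
        = (Measure.pi fun _ : Fin (n+3) => gaussianReal 0 1).map (fun x ↦ ∑ i, x i • e i) := by
      rw [← stdGaussian_eq_map_pi_orthonormalBasis e, ← map_pi_eq_stdGaussian, hξ]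
      rfl
    rw [hG, hH]
    have hp := aux_prob ξ ζ W hξm hζm hWm hζ hIndep1 hIndep2 (fun x => ∑ i, b i * x i)
      (fun x => ∑ i, (γ i + x i) ^ 2) (by fun_prop) (by fun_prop) κ c (√(1 - ‖b‖ ^ 2)) v hv
    rw [hp, hW]
    have hw : ∀ x : EuclideanSpace ℝ (Fin (n+3)),
        ∫⁻ w, (if c * w ^ 2 < ∑ i, (γ i + x i) ^ 2 then
        gaussianReal 0 v (Set.Icc (-(κ * w) + -(∑ i, b i * x i)) (κ * w + -(∑ i, b i * x i))) else 0)
          ∂(volume.withDensity fun w => ENNReal.ofReal (fW w))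
        = f (⟪e 0, x⟫_ℝ, ⟪e 1, x⟫_ℝ, ‖x‖ ^ 2) := by
      intro x
      have := aux_w fW hfWm hfW0 (fun w => I (-(∑ i, b i * x i), w)) (by fun_prop) c
        (∑ i, (γ i + x i) ^ 2) hc0
      simp only [hI] at this
      rw [this]
      have e1 : ∑ i, (γ i + x i) ^ 2 = ‖γ‖ ^ 2 + 2 * ‖γ‖ * ⟪e 0, x⟫_ℝ + ‖x‖ ^ 2 := by
        have t1 : ∑ i, (γ i + x i) ^ 2 = ‖γ + x‖ ^ 2 := by
          rw [EuclideanSpace.norm_sq_eq]; simp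
        have t2 : ⟪γ, x⟫_ℝ = ‖γ‖ * ⟪e 0, x⟫_ℝ := by
          conv_lhs => rw [heγ]
          rw [real_inner_smul_left]
        rw [t1, norm_add_sq_real, t2]
        ring
      have e2 : ∑ i, b i * x i = ‖b‖ * (ψ * ⟪e 0, x⟫_ℝ + √(1 - ψ ^ 2) * ⟪e 1, x⟫_ℝ) := by
        have t1 : ∑ i, b i * x i = ⟪b, x⟫_ℝ := by
          simp [PiLp.inner_apply, mul_comm]
        rw [t1]
        conv_lhs => rw [heb]
        rw [inner_add_left, real_inner_smul_left, real_inner_smul_left]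
        ring
      rw [e1, e2]
    simp only [hw]
    rw [hlaw, lintegral_map (by fun_prop) (by fun_prop)]
    refine lintegral_congr fun x => ?_
    have o : ∀ j, ⟪e j, ∑ i, x i • e i⟫_ℝ = x j := fun j =>
      e.orthonormal.inner_right_fintype x j
    rw [o, o]
    congr 3
    rw [← real_inner_self_eq_norm_sq, sum_inner]
    simp only [real_inner_smul_left, o, sq]
  have hlhs := hpi
  set cR : ℝ := (2 : ℝ) ^ (1 - ((n + 3 : ℕ) : ℝ) / 2) / Gamma (((n + 3 : ℕ) : ℝ) / 2) with hcR
  set c1 : ℝ := (π / (Gamma (1 / 2) * Gamma ((((n + 3 : ℕ) : ℝ) - 1) / 2)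
            / Gamma (1 / 2 + (((n + 3 : ℕ) : ℝ) - 1) / 2))) with hc1
  set c2 : ℝ := (π / (Gamma (1 / 2) * Gamma ((((n + 3 : ℕ) : ℝ) - 2) / 2)
            / Gamma (1 / 2 + (((n + 3 : ℕ) : ℝ) - 2) / 2))) with hc2
  have hn0 : (0:ℝ) ≤ n := n.cast_nonneg
  have p1 : 0 < Gamma (((n + 3 : ℕ) : ℝ) / 2) := Gamma_pos_of_pos (by positivity)
  have p2 : 0 < Gamma ((((n + 3 : ℕ) : ℝ) - 1) / 2) := Gamma_pos_of_pos (by push_cast; linarith)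
  have p3 : 0 < Gamma ((((n + 3 : ℕ) : ℝ) - 2) / 2) := Gamma_pos_of_pos (by push_cast; linarith)
  have p4 : 0 < Gamma (1 / 2 + (((n + 3 : ℕ) : ℝ) - 1) / 2) :=
    Gamma_pos_of_pos (by push_cast; linarith)
  have p5 : 0 < Gamma (1 / 2 + (((n + 3 : ℕ) : ℝ) - 2) / 2) :=
    Gamma_pos_of_pos (by push_cast; linarith)
  have p6 : 0 < Gamma (1 / 2 : ℝ) := Gamma_pos_of_pos (by norm_num)
  have hcR0 : 0 ≤ cR := by rw [hcR]; positivity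
  have hc10 : 0 ≤ c1 := by rw [hc1]; positivity
  have hc20 : 0 ≤ c2 := by rw [hc2]; positivity
  obtain ⟨d, hd⟩ : ∃ d : ℝ → ℝ, d = fun t => if n + 3 = 3 then cos (2 * π * t) else cos (π * t) :=
    ⟨_, rfl⟩
  have hdm : Measurable d := by
    rw [hd]; split_ifs <;> fun_prop
  rw [aux_spherical2 n f hfm d hd cR c1 c2 hcR0 hc10 hc20 (aux_const n)] at hpi
  set M : ℝ × ℝ × ℝ → ENNReal := fun p =>
    f (p.2.2 * cos (π * p.2.1), p.2.2 * sin (π * p.2.1) * d p.1, p.2.2 ^ 2) *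
          ENNReal.ofReal (cR * p.2.2 ^ (n+2) * rexp (-p.2.2^2/2)) * 
          ENNReal.ofReal (c1 * sin (π * p.2.1) ^ (n+1)) *
          ENNReal.ofReal (c2 * sin (π * p.1) ^ n) with hM
  have hMm : Measurable M := by fun_prop
  have hfin : ∫⁻ t₂ in Set.Icc (0:ℝ) 1, ∫⁻ t₁ in Set.Icc (0:ℝ) 1, ∫⁻ r in Set.Ioi (0:ℝ),
      M (t₂, t₁, r) ≠ ⊤ := by
    rw [← hpi]; exact measure_ne_top _ _
  have hB := aux_bochner3 _ _ _ M hMm hfin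
  rw [hpi, ← hB]
  have hsin : ∀ t ∈ Set.Icc (0:ℝ) 1, 0 ≤ sin (π * t) := fun t ht =>
    sin_nonneg_of_nonneg_of_le_pi (mul_nonneg pi_pos.le ht.1)
      (by nlinarith [ht.2, pi_pos])
  refine setIntegral_congr_fun measurableSet_Icc fun t₂ ht₂ => ?_
  refine setIntegral_congr_fun measurableSet_Icc fun t₁ ht₁ => ?_
  refine setIntegral_congr_fun measurableSet_Ioi fun r hr => ?_
  have hr : 0 < r := hr
  have h1 := hsin _ ht₁
  have h2 := hsin _ ht₂
  beta_reduce
  have efR : fR r = cR * r ^ (n+2) * rexp (-r^2/2) := by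
    rw [hfR]; simp [hr, hcR]
  have efT₁ : fT₁ t₁ = c1 * sin (π * t₁) ^ (n+1) := by
    rw [hfT₁]; rfl
  have efT₂ : fT₂ t₂ = c2 * sin (π * t₂) ^ n := by
    rw [hfT₂]; rfl
  have eu : u t₁ r = √((‖γ‖ ^ 2 + 2 * ‖γ‖ * (r * cos (π * t₁)) + r ^ 2) / c) := by
    rw [hu, hc]; beta_reduce; rw [mul_assoc (2 * ‖γ‖)]
  have ek : -(‖b‖ * r * k t₁ t₂) = -(‖b‖ * (ψ * (r * cos (π * t₁)) +
      √(1 - ψ ^ 2) * (r * sin (π * t₁) * d t₂))) := by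
    rw [hk, hd]; beta_reduce; split_ifs <;> ring
  simp only [hM, hf]
  rw [ENNReal.toReal_mul, ENNReal.toReal_mul, ENNReal.toReal_mul,
    ENNReal.toReal_ofReal (by positivity), ENNReal.toReal_ofReal (by positivity),
    ENNReal.toReal_ofReal (by positivity), ← efR, ← efT₁, ← efT₂, ← eu, ← ek]
  rw [← integral_toReal (by fun_prop)
    (Filter.Eventually.of_forall fun w =>
      (ENNReal.mul_ne_top (hIfin _) ENNReal.ofReal_ne_top).lt_top),
    ← integral_mul_const, ← integral_mul_const, ← integral_mul_const]
  refine integral_congr_ae (Filter.Eventually.of_forall fun w => ?_)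
  beta_reduce
  rw [ENNReal.toReal_mul, ENNReal.toReal_ofReal (hfWnn w), hiFun]
end

section
/- (Theorem 1, case s ≥ 3, ‖γ‖ > 0 and ψ ∈ {−1, 1}, via the Gaussian representation.) Let s ≥ 3 be an integer, b, γ ∈ ℝ^s with 0 < ‖b‖ < 1, ‖γ‖ > 0 and γ = c·b for some nonzero real c (so that ψ = (bᵀγ)/(‖b‖‖γ‖) ∈ {−1, 1}), let κ > 0, ℓ > 0, and let m be a positive integer. On a probability space let ξ = (ξ₁,…,ξ_s) have independent standard normal N(0,1) coordinates, let ζ ∼ N(0,1), and let W be a nonnegative random variable, with ξ, ζ, W mutually independent and W having Lebesgue density f_W(w) = (2 (m/2)^{m/2} / Γ(m/2)) w^{m−1} e^{−m w²/2} for w > 0 (and 0 otherwise). Define G = Σᵢ bᵢξᵢ + √(1−‖b‖²) ζ and H = γ + ξ. Then P( −κW ≤ G ≤ κW and HᵀH > sℓW² ) = ∫₀¹ ∫₀^∞ ∫₀^{u(t₁,r)} i( −‖b‖ r cos(πt₁), w ) f_W(w) f_R(r) f_{T₁}(t₁) dw dr dt₁, where f_R(r) = (2^{1−s/2}/Γ(s/2))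 r^{s−1} e^{−r²/2} for r > 0 (and 0 otherwise), f_{T₁}(t₁) = (π / B(1/2,(s−1)/2)) sin^{s−2}(π t₁) on [0,1], u(t₁, r) = √( (‖γ‖² + 2‖γ‖ r cos(πt₁) + r²) / (sℓ) ), and i(x, w) = P( −κw + x ≤ Z ≤ κw + x ) for Z ∼ N(0, 1 − ‖b‖²). -/
open MeasureTheory ProbabilityTheory Real
open scoped InnerProductSpace
open scoped ENNReal

lemma aux_pi_gauss (n : ℕ) (f : (Fin n → ℝ) → ℝ≥0∞) (hf : Measurable f) :
    ∫⁻ x, f x ∂(Measure.pi fun _ : Fin n => gaussianReal 0 1)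
      = ∫⁻ x, (∏ i, gaussianPDF 0 1 (x i)) * f x := by
  induction n with
  | zero =>
    have h : (Measure.pi fun _ : Fin 0 => gaussianReal 0 1) = (volume : Measure (Fin 0 → ℝ)) := by
      rw [volume_pi, Measure.pi_of_empty, Measure.pi_of_empty]
    rw [h]; simp
  | succ n ih =>
    have hp : Measurable fun x : Fin (n+1) → ℝ => (∏ i, gaussianPDF 0 1 (x i)) * f x := by
      refine Measurable.mul ?_ hf
      exact Finset.measurable_prod _ fun i _ => (measurable_gaussianPDF 0 1).comp (measurable_pi_apply i)
    rw [← (measurePreserving_piFinSuccAbove (fun _ : Fin (n+1) => gaussianReal 0 1) 0).symm.lintegral_comp hf,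
      ← (volume_preserving_piFinSuccAbove (fun _ : Fin (n+1) => ℝ) 0).symm.lintegral_comp hp]
    have hm := (MeasurableEquiv.piFinSuccAbove (fun _ : Fin (n+1) => ℝ) 0).symm.measurable
    have hfm : Measurable fun a => f ((MeasurableEquiv.piFinSuccAbove (fun _ : Fin (n+1) => ℝ) 0).symm a) :=
      hf.comp hm
    have hpm : Measurable fun a => (∏ i, gaussianPDF 0 1
        ((MeasurableEquiv.piFinSuccAbove (fun _ : Fin (n+1) => ℝ) 0).symm a i)) *
          f ((MeasurableEquiv.piFinSuccAbove (fun _ : Fin (n+1) => ℝ) 0).symm a) :=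
      hp.comp hm
    rw [Measure.volume_eq_prod]
    refine (lintegral_prod _ hfm.aemeasurable).trans (Eq.trans ?_ (lintegral_prod _ hpm.aemeasurable).symm)
    rw [gaussianReal_of_var_ne_zero 0 one_ne_zero]
    rw [lintegral_withDensity_eq_lintegral_mul _ (measurable_gaussianPDF 0 1)]
    · refine lintegral_congr fun y => ?_
      simp only [Pi.mul_apply]
      have := ih (fun z => f ((MeasurableEquiv.piFinSuccAbove (fun _ : Fin (n+1) => ℝ) 0).symm (y, z)))
        (hf.comp (hm.comp (by fun_prop)))
      rw [gaussianReal_of_var_ne_zero 0 one_ne_zero] at this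
      rw [this, ← lintegral_const_mul]
      · refine lintegral_congr fun z => ?_
        simp [MeasurableEquiv.piFinSuccAbove, Fin.prod_univ_succ, mul_assoc]
      · refine Measurable.mul ?_ (hf.comp (hm.comp (by fun_prop)))
        exact Finset.measurable_prod _ fun i _ => (measurable_gaussianPDF 0 1).comp (measurable_pi_apply i)
    · rw [← gaussianReal_of_var_ne_zero 0 one_ne_zero]
      exact (hf.comp hm).lintegral_prod_right'

lemma aux_lintegral_norm {E : Type*} [NormedAddCommGroup E] [NormedSpace ℝ E] [MeasurableSpace E]
    [BorelSpace E] [FiniteDimensional ℝ E] [Nontrivial E] (μ : Measure E) [μ.IsAddHaarMeasure]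
    (f : ℝ → ℝ≥0∞) (hf : Measurable f) :
    ∫⁻ x, f ‖x‖ ∂μ = (Module.finrank ℝ E * μ (Metric.ball 0 1)) *
      ∫⁻ y in Set.Ioi (0:ℝ), ENNReal.ofReal (y ^ (Module.finrank ℝ E - 1)) * f y :=
  calc
    ∫⁻ x, f ‖x‖ ∂μ = ∫⁻ x : ({(0)}ᶜ : Set E), f (‖x.1‖) ∂(μ.comap (↑)) := by
      rw [lintegral_subtype_comap (measurableSet_singleton _).compl fun x ↦ f (‖x‖),
        restrict_compl_singleton]
    _ = ∫⁻ x, f x.2 ∂μ.toSphere.prod (.volumeIoiPow (Module.finrank ℝ E - 1)) := by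
      simpa using μ.measurePreserving_homeomorphUnitSphereProd.lintegral_comp
        (f := f ∘ Subtype.val ∘ Prod.snd) (by fun_prop)
    _ = μ.toSphere Set.univ * ∫⁻ x : Set.Ioi (0 : ℝ), f x ∂.volumeIoiPow (Module.finrank ℝ E - 1) := by
      rw [lintegral_prod _ (by fun_prop)]
      simp [mul_comm]
    _ = _ := by
      rw [Measure.volumeIoiPow, lintegral_withDensity_eq_lintegral_mul _ (by fun_prop) (by fun_prop), μ.toSphere_apply_univ]
      congr 1
      exact lintegral_subtype_comap measurableSet_Ioi fun a ↦ ENNReal.ofReal (a ^ (Module.finrank ℝ E - 1)) * f a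

noncomputable def auxR (n : ℕ) (r : ℝ) : ℝ :=
  (2 : ℝ) ^ (1 - (n : ℝ) / 2) / Gamma ((n : ℝ) / 2) * r ^ (n - 1) * Real.exp (-r ^ 2 / 2)

lemma aux_radial_s19 (n : ℕ) (hn : 1 ≤ n) (f : ℝ → ℝ≥0∞) (hf : Measurable f) :
    ∫⁻ z, f (√(∑ i, z i ^ 2)) ∂(Measure.pi fun _ : Fin n => gaussianReal 0 1)
      = ∫⁻ ρ in Set.Ioi (0:ℝ), ENNReal.ofReal (auxR n ρ) * f ρ := by
  rw [aux_pi_gauss n _ (by fun_prop)]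
  have : Nonempty (Fin n) := ⟨⟨0, hn⟩⟩
  have hpos : (0:ℝ) < n := by exact_mod_cast hn
  have h1 : ∀ z : Fin n → ℝ, (∏ i, gaussianPDF 0 1 (z i)) * f (√(∑ i, z i ^ 2))
      = (fun ρ : ℝ => ENNReal.ofReal ((√(2 * π))⁻¹ ^ n * Real.exp (-ρ ^ 2 / 2)) * f ρ)
          ‖WithLp.toLp 2 z‖ := by
    intro z
    have hnz : ‖WithLp.toLp 2 z‖ = √(∑ i, z i ^ 2) := by
      simp [EuclideanSpace.norm_eq]
    simp only [hnz]
    rw [Real.sq_sqrt (Finset.sum_nonneg fun i _ => sq_nonneg _)]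
    congr 1
    simp only [gaussianPDF]
    rw [← ENNReal.ofReal_prod_of_nonneg (fun i _ => gaussianPDFReal_nonneg _ _ _)]
    congr 1
    simp only [gaussianPDFReal]
    simp [Finset.prod_mul_distrib, ← Real.exp_sum, Finset.sum_div, Finset.sum_neg_distrib, neg_div]
  simp_rw [h1]
  rw [(PiLp.volume_preserving_toLp (Fin n)).lintegral_comp
    (f := fun x : EuclideanSpace ℝ (Fin n) => (fun ρ : ℝ => ENNReal.ofReal ((√(2 * π))⁻¹ ^ n * Real.exp (-ρ ^ 2 / 2)) * f ρ) ‖x‖) (by fun_prop)]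
  refine (aux_lintegral_norm (E := EuclideanSpace ℝ (Fin n)) volume (fun ρ : ℝ => ENNReal.ofReal ((√(2 * π))⁻¹ ^ n * Real.exp (-ρ ^ 2 / 2)) * f ρ) (by fun_prop)).trans ?_
  rw [EuclideanSpace.volume_ball]
  rw [← lintegral_const_mul _ (by fun_prop)]
  refine setLIntegral_congr_fun measurableSet_Ioi fun ρ hρ => ?_
  have hρ' : (0:ℝ) < ρ := hρ
  simp only [finrank_euclideanSpace, Fintype.card_fin, ENNReal.ofReal_one, one_pow, one_mul]
  have hG : 0 < Gamma ((n:ℝ)/2) := Gamma_pos_of_pos (by positivity)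
  have hG1 : Gamma ((n:ℝ)/2 + 1) = n/2 * Gamma ((n:ℝ)/2) := Gamma_add_one (by positivity)
  rw [hG1, ← ENNReal.ofReal_natCast, ← ENNReal.ofReal_mul (by positivity), ← mul_assoc,
    ← mul_assoc, ← ENNReal.ofReal_mul (by positivity), ← ENNReal.ofReal_mul (by positivity)]
  congr 2
  unfold auxR
  have h2 : (2:ℝ) ^ (1 - (n:ℝ)/2) = 2 * (√2)⁻¹ ^ n := by
    rw [Real.rpow_sub (by norm_num), Real.rpow_one, Real.sqrt_eq_rpow, ← Real.rpow_neg (by norm_num),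
      ← Real.rpow_natCast, ← Real.rpow_mul (by norm_num), div_eq_mul_inv, ← Real.rpow_neg (by norm_num)]
    congr 2; ring
  rw [h2, Real.sqrt_mul (by norm_num)]
  have : √π ≠ 0 := by positivity
  have : √2 ≠ 0 := by positivity
  field_simp
  rw [← mul_pow]; congr 1; field_simp

lemma aux_split (n : ℕ) (e : EuclideanSpace ℝ (Fin (n+1))) (he : ‖e‖ = 1)
    (Φ : ℝ × ℝ → ℝ≥0∞) (hΦ : Measurable Φ) :
    ∫⁻ x, Φ (‖x‖, ⟪e, x⟫_ℝ) ∂(stdGaussian (EuclideanSpace ℝ (Fin (n+1))))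
      = ∫⁻ y, ∫⁻ z, Φ (√(y ^ 2 + ∑ i, z i ^ 2), y) ∂(Measure.pi fun _ : Fin n => gaussianReal 0 1)
          ∂(gaussianReal 0 1) := by
  obtain ⟨v, hv⟩ := Orthonormal.exists_orthonormalBasis_extension_of_card_eq (𝕜 := ℝ)
    (E := EuclideanSpace ℝ (Fin (n+1))) (ι := Fin (n+1)) (by simp) (v := fun _ => e) (s := {0}) (by
      refine ⟨fun i => by simpa using he, fun i j hij => ?_⟩
      exact absurd (Subsingleton.elim i j) hij)
  have hv0 : v 0 = e := hv 0 rfl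
  rw [stdGaussian_eq_map_pi_orthonormalBasis v, lintegral_map (by fun_prop) (by fun_prop)]
  have h1 : ∀ x : Fin (n+1) → ℝ, ‖∑ i, x i • v i‖ = √(∑ i, x i ^ 2) := by
    intro x
    have : ∑ i, x i • v i = v.repr.symm (WithLp.toLp 2 x) := by
      rw [← v.sum_repr_symm]
    rw [this, LinearIsometryEquiv.norm_map]
    simp [EuclideanSpace.norm_eq]
  have h2 : ∀ x : Fin (n+1) → ℝ, ⟪e, ∑ i, x i • v i⟫_ℝ = x 0 := by
    intro x
    rw [← hv0]
    exact v.orthonormal.inner_right_fintype x 0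
  simp_rw [h1, h2]
  have hm : Measurable fun x : Fin (n+1) → ℝ => Φ (√(∑ i, x i ^ 2), x 0) := by fun_prop
  rw [← (measurePreserving_piFinSuccAbove (fun _ : Fin (n+1) => gaussianReal 0 1) 0).symm.lintegral_comp hm]
  have hm2 := (MeasurableEquiv.piFinSuccAbove (fun _ : Fin (n+1) => ℝ) 0).symm.measurable
  refine (lintegral_prod _ (hm.comp hm2).aemeasurable).trans ?_
  simp [MeasurableEquiv.piFinSuccAbove, Fin.sum_univ_succ]

noncomputable def auxT (s : ℕ) (t : ℝ) : ℝ :=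
  π / (Gamma (1 / 2) * Gamma (((s : ℝ) - 1) / 2) / Gamma (1 / 2 + ((s : ℝ) - 1) / 2))
    * Real.sin (π * t) ^ (s - 2)

lemma aux_const_s19 (n : ℕ) (hn : 1 ≤ n) (r t : ℝ) :
    π * (r * (gaussianPDFReal 0 1 (r * Real.cos (π * t)) * auxR n (r * Real.sin (π * t))))
      = auxR (n+1) r * auxT (n+1) t := by
  have hpos : (0:ℝ) < n := by exact_mod_cast hn
  unfold auxR auxT gaussianPDFReal
  have e1 : ((n + 1 : ℕ):ℝ) - 1 = n := by push_cast; ring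
  have e2 : (1/2:ℝ) + (n:ℝ)/2 = ((n+1:ℕ):ℝ)/2 := by push_cast; ring
  have hG : 0 < Gamma ((n:ℝ)/2) := Gamma_pos_of_pos (by positivity)
  have hG1 : 0 < Gamma (((n+1:ℕ):ℝ)/2) := Gamma_pos_of_pos (by positivity)
  rw [e1, e2, Real.Gamma_one_half_eq]
  have e3 : (2:ℝ) ^ (1 - (n:ℝ)/2) = √2 * 2 ^ (1 - ((n+1:ℕ):ℝ)/2) := by
    rw [Real.sqrt_eq_rpow, ← Real.rpow_add (by norm_num)]
    congr 1; push_cast; ring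
  have e4 : Real.exp (-r^2/2) = Real.exp (-(r * Real.cos (π * t) - 0)^2 / (2 * ((1:NNReal):ℝ)))
      * Real.exp (-(r * Real.sin (π * t))^2/2) := by
    rw [← Real.exp_add]
    congr 1
    have := Real.sin_sq_add_cos_sq (π * t)
    simp only [NNReal.coe_one]
    linear_combination (r^2/2) * this
  have e5 : n + 1 - 1 = (n - 1) + 1 := by omega
  have e6 : n + 1 - 2 = n - 1 := by omega
  rw [e3, e4, e5, e6, mul_pow, pow_succ]
  simp only [NNReal.coe_one, mul_one]
  rw [Real.sqrt_mul (by norm_num)]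
  have : √π ≠ 0 := by positivity
  have : √2 ≠ 0 := by positivity
  have hpi : √π * √π = π := Real.mul_self_sqrt pi_pos.le
  field_simp
  ring

lemma aux_polar_s19 (n : ℕ) (hn : 1 ≤ n) (e : EuclideanSpace ℝ (Fin (n+1))) (he : ‖e‖ = 1)
    (Φ : ℝ × ℝ → ℝ≥0∞) (hΦ : Measurable Φ) :
    ∫⁻ x, Φ (‖x‖, ⟪e, x⟫_ℝ) ∂(stdGaussian (EuclideanSpace ℝ (Fin (n+1))))
      = ∫⁻ t in Set.Icc (0:ℝ) 1, ∫⁻ r in Set.Ioi (0:ℝ),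
          ENNReal.ofReal (auxR (n+1) r * auxT (n+1) t) * Φ (r, r * Real.cos (π * t)) := by
  have hR : Measurable (auxR n) := by unfold auxR; fun_prop
  have hg : Measurable (gaussianPDF 0 1) := measurable_gaussianPDF 0 1
  rw [aux_split n e he Φ hΦ]
  have h1 : ∀ y : ℝ, ∫⁻ z, Φ (√(y ^ 2 + ∑ i, z i ^ 2), y) ∂(Measure.pi fun _ : Fin n => gaussianReal 0 1)
      = ∫⁻ ρ in Set.Ioi (0:ℝ), ENNReal.ofReal (auxR n ρ) * Φ (√(y^2 + ρ^2), y) := by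
    intro y
    rw [← aux_radial_s19 n hn (fun ρ => Φ (√(y^2 + ρ^2), y)) (by fun_prop)]
    refine lintegral_congr fun z => ?_
    rw [Real.sq_sqrt (Finset.sum_nonneg fun i _ => sq_nonneg _)]
  simp_rw [h1]
  let F : ℝ × ℝ → ℝ≥0∞ := fun p => gaussianPDF 0 1 p.1 *
    (Set.Ioi (0:ℝ)).indicator (fun ρ => ENNReal.ofReal (auxR n ρ) * Φ (√(p.1^2 + ρ^2), p.1)) p.2
  have hF : Measurable F := by
    have : F = fun p => gaussianPDF 0 1 p.1 *
      ({p : ℝ × ℝ | 0 < p.2}).indicator (fun p => ENNReal.ofReal (auxR n p.2) * Φ (√(p.1^2 + p.2^2), p.1)) p := by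
      funext p; simp [F, Set.indicator]
    rw [this]
    refine Measurable.mul (by fun_prop) (Measurable.indicator (by fun_prop) ?_)
    exact measurableSet_lt measurable_const measurable_snd
  have h2 : ∫⁻ y, (∫⁻ ρ in Set.Ioi (0:ℝ), ENNReal.ofReal (auxR n ρ) * Φ (√(y^2 + ρ^2), y)) ∂(gaussianReal 0 1)
      = ∫⁻ p, F p := by
    rw [Measure.volume_eq_prod, lintegral_prod _ hF.aemeasurable,
      gaussianReal_of_var_ne_zero 0 one_ne_zero,
      lintegral_withDensity_eq_lintegral_mul _ hg]
    · refine lintegral_congr fun y => ?_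
      simp only [Pi.mul_apply, F]
      rw [lintegral_const_mul _ (Measurable.indicator (by fun_prop) measurableSet_Ioi),
        lintegral_indicator measurableSet_Ioi]
    · exact Measurable.lintegral_prod_right' (f := fun p : ℝ × ℝ => ENNReal.ofReal (auxR n p.2) * Φ (√(p.1^2 + p.2^2), p.1)) (by fun_prop)
  rw [h2, ← lintegral_comp_polarCoord_symm]
  have h3 : polarCoord.target = Set.Ioi (0:ℝ) ×ˢ Set.Ioo (-π) π := rfl
  have h4 : ∀ p : ℝ × ℝ, polarCoord.symm p = (p.1 * Real.cos p.2, p.1 * Real.sin p.2) := fun p => rfl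
  have hK : Measurable fun p : ℝ × ℝ => ENNReal.ofReal p.1 * F (p.1 * Real.cos p.2, p.1 * Real.sin p.2) := by
    fun_prop
  simp_rw [h3, h4, smul_eq_mul]
  rw [Measure.volume_eq_prod, ← Measure.prod_restrict, lintegral_prod_symm' _ hK]
  have h5 : ∫⁻ θ in Set.Ioo (-π) π, ∫⁻ r in Set.Ioi (0:ℝ),
        ENNReal.ofReal r * F (r * Real.cos θ, r * Real.sin θ)
      = ∫⁻ θ in Set.Ioo 0 π, ∫⁻ r in Set.Ioi (0:ℝ),
        ENNReal.ofReal r * F (r * Real.cos θ, r * Real.sin θ) := by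
    rw [← lintegral_indicator measurableSet_Ioo, ← lintegral_indicator measurableSet_Ioo]
    refine lintegral_congr fun θ => ?_
    by_cases h : θ ∈ Set.Ioo 0 π
    · rw [Set.indicator_of_mem h, Set.indicator_of_mem (show θ ∈ Set.Ioo (-π) π from ⟨by linarith [h.1, pi_pos], h.2⟩)]
    · rw [Set.indicator_of_notMem h]
      by_cases h' : θ ∈ Set.Ioo (-π) π
      · rw [Set.indicator_of_mem h']
        have hθ : θ ≤ 0 := by
          by_contra hc
          exact h ⟨not_le.1 hc, h'.2⟩
        have hsin : Real.sin θ ≤ 0 := Real.sin_nonpos_of_nonpos_of_neg_pi_le hθ h'.1.le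
        rw [setLIntegral_congr_fun (g := fun _ => 0) measurableSet_Ioi]
        · simp
        · intro r hr
          have : ¬ (0 < r * Real.sin θ) := not_lt.2 (mul_nonpos_of_nonneg_of_nonpos (le_of_lt hr) hsin)
          simp [F, Set.indicator, this]
      · rw [Set.indicator_of_notMem h']
  refine h5.trans ?_
  have h6 : (fun t : ℝ => π * t) '' Set.Ioo 0 1 = Set.Ioo 0 π := by
    rw [Set.image_mul_left_Ioo pi_pos]; simp
  rw [← h6, lintegral_image_eq_lintegral_abs_deriv_mul measurableSet_Ioo
    (f' := fun _ => π) (fun t _ => by simpa using ((hasDerivAt_id t).const_mul π).hasDerivWithinAt)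
    (fun a _ b _ h => mul_left_cancel₀ pi_ne_zero h)]
  rw [setLIntegral_congr Ioo_ae_eq_Icc.symm]
  refine setLIntegral_congr_fun measurableSet_Ioo fun t ht => ?_
  try simp only
  rw [← lintegral_const_mul _ (by fun_prop)]
  refine setLIntegral_congr_fun measurableSet_Ioi fun r hr => ?_
  have hr' : (0:ℝ) < r := hr
  have hs : 0 < Real.sin (π * t) := Real.sin_pos_of_pos_of_lt_pi (mul_pos pi_pos ht.1)
    (by nlinarith [ht.2, pi_pos])
  have hrs : 0 < r * Real.sin (π * t) := by positivity
  have hsq : √((r * Real.cos (π * t))^2 + (r * Real.sin (π * t))^2) = r := by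
    rw [show (r * Real.cos (π * t))^2 + (r * Real.sin (π * t))^2 = r^2 by
      linear_combination r^2 * Real.sin_sq_add_cos_sq (π * t), Real.sqrt_sq hr'.le]
  simp only [F, Set.indicator, Set.mem_Ioi, hrs, if_true, hsq]
  rw [← aux_const_s19 n hn r t, abs_of_pos pi_pos, ENNReal.ofReal_mul pi_pos.le, ENNReal.ofReal_mul hr'.le,
    ENNReal.ofReal_mul (gaussianPDFReal_nonneg _ _ _)]
  simp only [gaussianPDF]
  ring

lemma aux_meas_J (N : Measure ℝ) [IsProbabilityMeasure N] (κ : ℝ) :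
    Measurable fun p : ℝ × ℝ => N (Set.Icc (-(κ * p.2) + p.1) (κ * p.2 + p.1)) := by
  have hS : MeasurableSet {q : (ℝ × ℝ) × ℝ | -(κ * q.1.2) + q.1.1 ≤ q.2 ∧ q.2 ≤ κ * q.1.2 + q.1.1} := by
    rw [Set.ofPred_and]
    exact (measurableSet_le (by fun_prop) (by fun_prop)).inter (measurableSet_le (by fun_prop) (by fun_prop))
  exact measurable_measure_prodMk_left hS

lemma aux_J_symm (v : NNReal) (κ x w : ℝ) :
    gaussianReal 0 v (Set.Icc (-(κ * w) + -x) (κ * w + -x))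
      = gaussianReal 0 v (Set.Icc (-(κ * w) + x) (κ * w + x)) := by
  have h : (gaussianReal 0 v).map (fun y => -y) = gaussianReal 0 v := by
    simpa using gaussianReal_map_neg (μ := 0) (v := v)
  conv_lhs => rw [← h]
  rw [Measure.map_apply measurable_neg measurableSet_Icc]
  congr 1
  ext y
  simp only [Set.mem_preimage, Set.mem_Icc]
  constructor <;> rintro ⟨h1, h2⟩ <;> constructor <;> linarith

lemma aux_gauss_affine (β κ w x : ℝ) (hβ : β < 1) :
    gaussianReal 0 1 {z : ℝ | -(κ * w) ≤ x + √(1 - β) * z ∧ x + √(1 - β) * z ≤ κ * w}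
      = gaussianReal 0 (Real.toNNReal (1 - β)) (Set.Icc (-(κ * w) + -x) (κ * w + -x)) := by
  have h := gaussianReal_map_const_mul (μ := 0) (v := 1) (√(1 - β))
  have h2 : (NNReal.mk (√(1 - β) ^ 2) (sq_nonneg _) * 1 : NNReal) = Real.toNNReal (1 - β) := by
    ext
    simp [Real.sq_sqrt (by linarith : 0 ≤ 1 - β), hβ.le]
  rw [h2, mul_zero] at h
  rw [← h, Measure.map_apply (by fun_prop) measurableSet_Icc]
  congr 1
  ext y
  simp only [Set.mem_preimage, Set.mem_Icc, Set.mem_ofPred_eq]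
  constructor <;> rintro ⟨h1, h2⟩ <;> constructor <;> linarith

theorem stmt19 {Ω : Type*} [MeasureSpace Ω] [IsProbabilityMeasure (ℙ : Measure Ω)]
    (s : ℕ) (hs : 3 ≤ s)
    (b γ : EuclideanSpace ℝ (Fin s))
    (hb0 : 0 < ‖b‖) (hb1 : ‖b‖ < 1) (hγ : 0 < ‖γ‖)
    (c : ℝ) (hc : c ≠ 0) (hγb : γ = c • b)
    (κ ℓ : ℝ) (hκ : 0 < κ) (hℓ : 0 < ℓ) (m : ℕ) (hm : 0 < m)
    (ξ : Ω → EuclideanSpace ℝ (Fin s)) (ζ W : Ω → ℝ)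
    (hξm : Measurable ξ) (hζm : Measurable ζ) (hWm : Measurable W)
    (hξ : Measure.map ξ ℙ
      = Measure.map (⇑(EuclideanSpace.equiv (Fin s) ℝ).symm)
          (Measure.pi fun _ : Fin s => gaussianReal 0 1))
    (hζ : Measure.map ζ ℙ = gaussianReal 0 1)
    (hIndep1 : IndepFun ξ ζ ℙ)
    (hIndep2 : IndepFun (fun ω => (ξ ω, ζ ω)) W ℙ)
    (hWnn : ∀ ω, 0 ≤ W ω)
    (fW : ℝ → ℝ)
    (hfW : fW = fun w => if 0 < w then
        2 * ((m : ℝ) / 2) ^ ((m : ℝ) / 2) / Gamma ((m : ℝ) / 2) * w ^ (m - 1)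
          * Real.exp (-(m : ℝ) * w ^ 2 / 2)
      else 0)
    (hW : Measure.map W ℙ = volume.withDensity fun w => ENNReal.ofReal (fW w))
    (G : Ω → ℝ)
    (hG : G = fun ω => (∑ i, b i * ξ ω i) + Real.sqrt (1 - ‖b‖ ^ 2) * ζ ω)
    (H : Ω → Fin s → ℝ)
    (hH : H = fun ω i => γ i + ξ ω i)
    (fR : ℝ → ℝ)
    (hfR : fR = fun r => if 0 < r then
        (2 : ℝ) ^ (1 - (s : ℝ) / 2) / Gamma ((s : ℝ) / 2) * r ^ (s - 1)
          * Real.exp (-r ^ 2 / 2)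
      else 0)
    (fT₁ : ℝ → ℝ)
    (hfT₁ : fT₁ = fun t₁ =>
      π / (Gamma (1 / 2) * Gamma (((s : ℝ) - 1) / 2)
            / Gamma (1 / 2 + ((s : ℝ) - 1) / 2))
        * Real.sin (π * t₁) ^ (s - 2))
    (u : ℝ → ℝ → ℝ)
    (hu : u = fun t₁ r => Real.sqrt
      ((‖γ‖ ^ 2 + 2 * ‖γ‖ * r * Real.cos (π * t₁) + r ^ 2) / ((s : ℝ) * ℓ)))
    (iFun : ℝ → ℝ → ℝ)
    (hiFun : iFun = fun x w =>
      (gaussianReal 0 (Real.toNNReal (1 - ‖b‖ ^ 2))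
        (Set.Icc (-(κ * w) + x) (κ * w + x))).toReal) :
    (ℙ {ω | (-(κ * W ω) ≤ G ω ∧ G ω ≤ κ * W ω) ∧
        (∑ i, (H ω i) ^ 2) > (s : ℝ) * ℓ * (W ω) ^ 2}).toReal
      = ∫ t₁ in Set.Icc (0 : ℝ) 1, ∫ r in Set.Ioi (0 : ℝ),
          ∫ w in Set.Ioc (0 : ℝ) (u t₁ r),
            iFun (-(‖b‖ * r * Real.cos (π * t₁))) w * fW w * fR r * fT₁ t₁ := by
  obtain ⟨n, rfl⟩ : ∃ n, s = n + 1 := ⟨s - 1, by omega⟩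
  have hn : 1 ≤ n := by omega
  have hspos : (0:ℝ) < ((n+1 : ℕ):ℝ) := by positivity
  have hsl : (0:ℝ) < ((n+1 : ℕ):ℝ) * ℓ := by positivity
  have hmpos : (0:ℝ) < m := by exact_mod_cast hm
  -- facts about `fW`
  have hfWm : Measurable fW := by
    rw [hfW]
    exact Measurable.ite measurableSet_Ioi (by fun_prop) measurable_const
  have hfW0 : ∀ w, w ≤ 0 → fW w = 0 := by
    intro w hw; rw [hfW]; simp [not_lt.2 hw]
  have hfWnn : ∀ w, 0 ≤ fW w := by
    intro w; rw [hfW]; simp only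
    have hG := Gamma_pos_of_pos (show (0:ℝ) < (m:ℝ)/2 by positivity)
    split_ifs with h <;> positivity
  have hWprob : IsProbabilityMeasure (volume.withDensity fun w => ENNReal.ofReal (fW w)) := by
    rw [← hW]; exact Measure.isProbabilityMeasure_map hWm.aemeasurable
  have hW1 : ∫⁻ w, ENNReal.ofReal (fW w) = 1 := by
    have := hWprob.measure_univ
    rwa [withDensity_apply _ MeasurableSet.univ, Measure.restrict_univ] at this
  -- the Gaussian strip probability
  set N : Measure ℝ := gaussianReal 0 (Real.toNNReal (1 - ‖b‖ ^ 2)) with hN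
  let J : ℝ × ℝ → ℝ≥0∞ := fun p => N (Set.Icc (-(κ * p.2) + p.1) (κ * p.2 + p.1))
  have hJm : Measurable J := aux_meas_J N κ
  have hJ1 : ∀ p, J p ≤ 1 := fun p => prob_le_one
  have hJs : ∀ x w, J (-x, w) = J (x, w) := fun x w => aux_J_symm _ κ x w
  let A : ℝ × ℝ → ℝ := fun q => √((‖γ‖ ^ 2 + 2 * ‖γ‖ * q.2 + q.1 ^ 2) / (((n+1 : ℕ):ℝ) * ℓ))
  have hAm : Measurable A := by fun_prop
  let Φ : ℝ × ℝ → ℝ≥0∞ := fun q => ∫⁻ w in Set.Ioc 0 (A q), J (-(‖b‖ * q.2), w) * ENNReal.ofReal (fW w)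
  have hΦm : Measurable Φ := by
    have : Φ = fun q => ∫⁻ w, ({p : (ℝ × ℝ) × ℝ | 0 < p.2 ∧ p.2 ≤ A p.1}).indicator
        (fun p => J (-(‖b‖ * p.1.2), p.2) * ENNReal.ofReal (fW p.2)) (q, w) := by
      funext q
      simp only [Φ]
      rw [← lintegral_indicator measurableSet_Ioc]
      rfl
    rw [this]
    refine Measurable.lintegral_prod_right' (f := fun p : (ℝ × ℝ) × ℝ => _) ?_
    refine Measurable.indicator (by fun_prop) ?_
    rw [Set.ofPred_and]
    exact (measurableSet_lt (by fun_prop) (by fun_prop)).inter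
      (measurableSet_le (by fun_prop) (by fun_prop))
  have hΦ1 : ∀ q, Φ q ≤ 1 := by
    intro q
    rw [← hW1]
    refine (lintegral_mono fun w => ?_).trans (setLIntegral_le_lintegral _ _)
    exact mul_le_of_le_one_left' (hJ1 _)
  -- direction
  set e : EuclideanSpace ℝ (Fin (n+1)) := ‖γ‖⁻¹ • γ with he
  have he1 : ‖e‖ = 1 := by rw [he, norm_smul, norm_inv, norm_norm, inv_mul_cancel₀ hγ.ne']
  have hγe : ∀ x, ⟪γ, x⟫_ℝ = ‖γ‖ * ⟪e, x⟫_ℝ := by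
    intro x; rw [he, real_inner_smul_left, ← mul_assoc, mul_inv_cancel₀ hγ.ne', one_mul]
  have hJb : ∀ x w, J (-⟪b, x⟫_ℝ, w) = J (-(‖b‖ * ⟪e, x⟫_ℝ), w) := by
    intro x w
    have h1 : ‖b‖ * ⟪e, x⟫_ℝ = (c / |c|) * ⟪b, x⟫_ℝ := by
      rw [he, real_inner_smul_left, hγb, real_inner_smul_left, norm_smul, Real.norm_eq_abs]
      have := abs_pos.2 hc
      field_simp
    rw [h1]
    rcases lt_or_gt_of_ne hc with h | h
    · rw [abs_of_neg h, div_neg, div_self hc, hJs, hJs, neg_one_mul, hJs]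
    · rw [abs_of_pos h, div_self hc, one_mul]
  -- law of the triple
  have hstd : Measure.map ξ ℙ = stdGaussian (EuclideanSpace ℝ (Fin (n+1))) := by
    rw [hξ, ← map_pi_eq_stdGaussian]; rfl
  have hlaw : Measure.map (fun ω => ((ξ ω, ζ ω), W ω)) ℙ
      = ((stdGaussian (EuclideanSpace ℝ (Fin (n+1)))).prod (gaussianReal 0 1)).prod
          (volume.withDensity fun w => ENNReal.ofReal (fW w)) := by
    rw [(indepFun_iff_map_prod_eq_prod_map_map (hξm.prodMk hζm).aemeasurable hWm.aemeasurable).1 hIndep2,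
      (indepFun_iff_map_prod_eq_prod_map_map hξm.aemeasurable hζm.aemeasurable).1 hIndep1, hstd, hζ, hW]
  let T : Set ((EuclideanSpace ℝ (Fin (n+1)) × ℝ) × ℝ) :=
    {p | (-(κ * p.2) ≤ ⟪b, p.1.1⟫_ℝ + √(1 - ‖b‖ ^ 2) * p.1.2 ∧
      ⟪b, p.1.1⟫_ℝ + √(1 - ‖b‖ ^ 2) * p.1.2 ≤ κ * p.2) ∧
      ((n+1 : ℕ):ℝ) * ℓ * p.2 ^ 2 < ‖γ + p.1.1‖ ^ 2}
  have hT : MeasurableSet T := by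
    simp only [T, Set.ofPred_and]
    exact ((measurableSet_le (by fun_prop) (by fun_prop)).inter
      (measurableSet_le (by fun_prop) (by fun_prop))).inter
      (measurableSet_lt (by fun_prop) (by fun_prop))
  have hev : {ω | (-(κ * W ω) ≤ G ω ∧ G ω ≤ κ * W ω) ∧
        (∑ i, (H ω i) ^ 2) > ((n+1 : ℕ) : ℝ) * ℓ * (W ω) ^ 2}
      = (fun ω => ((ξ ω, ζ ω), W ω)) ⁻¹' T := by
    ext ω
    have h1 : ∑ i, b i * ξ ω i = ⟪b, ξ ω⟫_ℝ := by
      simp [PiLp.inner_apply, mul_comm]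
    have h2 : ∑ i, (γ i + ξ ω i) ^ 2 = ‖γ + ξ ω‖ ^ 2 := by
      simp [EuclideanSpace.real_norm_sq_eq]
    simp only [hG, hH, T, Set.mem_preimage, Set.mem_ofPred_eq, h1, h2, gt_iff_lt]
  let Q : EuclideanSpace ℝ (Fin (n+1)) → ℝ → ℝ≥0∞ := fun x w =>
    if ((n+1 : ℕ):ℝ) * ℓ * w ^ 2 < ‖γ + x‖ ^ 2 then J (-⟪b, x⟫_ℝ, w) else 0
  have hQm : Measurable (Function.uncurry Q) := by
    refine Measurable.ite (measurableSet_lt (by fun_prop) (by fun_prop)) ?_ measurable_const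
    exact hJm.comp (by fun_prop)
  have hP : ℙ {ω | (-(κ * W ω) ≤ G ω ∧ G ω ≤ κ * W ω) ∧
        (∑ i, (H ω i) ^ 2) > ((n+1 : ℕ) : ℝ) * ℓ * (W ω) ^ 2}
      = ∫⁻ x, Φ (‖x‖, ⟪e, x⟫_ℝ) ∂(stdGaussian (EuclideanSpace ℝ (Fin (n+1)))) := by
    rw [hev, ← Measure.map_apply (by fun_prop) hT, hlaw, Measure.prod_apply_symm hT]
    have h1 : ∀ w, ((stdGaussian (EuclideanSpace ℝ (Fin (n+1)))).prod (gaussianReal 0 1))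
          ((fun q => (q, w)) ⁻¹' T)
        = ∫⁻ x, Q x w ∂(stdGaussian (EuclideanSpace ℝ (Fin (n+1)))) := by
      intro w
      rw [Measure.prod_apply (hT.preimage (by fun_prop))]
      refine lintegral_congr fun x => ?_
      by_cases h : ((n+1 : ℕ):ℝ) * ℓ * w ^ 2 < ‖γ + x‖ ^ 2
      · simp only [Q, h, if_true]
        refine Eq.trans ?_ (aux_gauss_affine (‖b‖ ^ 2) κ w ⟪b, x⟫_ℝ (by nlinarith))
        congr 1
        ext z
        simp only [T, Set.mem_preimage, Set.mem_ofPred_eq, h, and_true]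
      · simp only [Q, h, if_false]
        convert measure_empty (μ := gaussianReal 0 1)
        ext z
        simp only [T, Set.mem_preimage, Set.mem_ofPred_eq, h, and_false, Set.mem_empty_iff_false]
    simp_rw [h1]
    rw [lintegral_lintegral_swap (by exact (hQm.comp measurable_swap).aemeasurable)]
    refine lintegral_congr fun x => ?_
    have hQx : Measurable (Q x) := hQm.comp (measurable_prodMk_left (x := x))
    have hfWe : Measurable fun w => ENNReal.ofReal (fW w) := hfWm.ennreal_ofReal
    rw [lintegral_withDensity_eq_lintegral_mul _ hfWe hQx]
    simp only [Φ]
    rw [setLIntegral_congr Ioo_ae_eq_Ioc.symm, ← lintegral_indicator measurableSet_Ioo]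
    refine lintegral_congr fun w => ?_
    have hA : A (‖x‖, ⟪e, x⟫_ℝ) = √(‖γ + x‖ ^ 2 / (((n+1 : ℕ):ℝ) * ℓ)) := by
      simp only [A]
      rw [norm_add_sq_real, hγe, mul_assoc]
    simp only [Pi.mul_apply, Set.indicator, Set.mem_Ioo, hA]
    by_cases hw : 0 < w
    · have hiff : (w < √(‖γ + x‖ ^ 2 / (((n+1 : ℕ):ℝ) * ℓ))) ↔ ((n+1 : ℕ):ℝ) * ℓ * w ^ 2 < ‖γ + x‖ ^ 2 := by
        rw [Real.lt_sqrt hw.le, lt_div_iff₀ hsl, mul_comm]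
      simp only [hw, true_and, hiff, Q]
      split_ifs
      · rw [hJb, mul_comm]
      · simp
    · simp [hw, hfW0 w (not_lt.1 hw)]
  rw [aux_polar_s19 n hn e he1 Φ hΦm] at hP
  have hfin : ∫⁻ t in Set.Icc (0:ℝ) 1, ∫⁻ r in Set.Ioi (0:ℝ),
      ENNReal.ofReal (auxR (n+1) r * auxT (n+1) t) * Φ (r, r * Real.cos (π * t)) ≠ ∞ := by
    rw [← hP]; exact measure_ne_top _ _
  have hRm : Measurable (auxR (n+1)) := by unfold auxR; fun_prop
  have hTm : Measurable (auxT (n+1)) := by unfold auxT; fun_prop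
  have hKm : Measurable fun p : ℝ × ℝ =>
      ENNReal.ofReal (auxR (n+1) p.2 * auxT (n+1) p.1) * Φ (p.2, p.2 * Real.cos (π * p.1)) := by
    fun_prop
  have hBm : Measurable fun t : ℝ => ∫⁻ r in Set.Ioi (0:ℝ),
      ENNReal.ofReal (auxR (n+1) r * auxT (n+1) t) * Φ (r, r * Real.cos (π * t)) :=
    Measurable.lintegral_prod_right' hKm
  rw [hP, ← integral_toReal hBm.aemeasurable (ae_lt_top hBm hfin)]
  refine setIntegral_congr_fun measurableSet_Icc fun t ht => ?_
  try simp only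
  rw [← integral_toReal (by fun_prop) (Filter.Eventually.of_forall fun r =>
    ENNReal.mul_lt_top ENNReal.ofReal_lt_top ((hΦ1 _).trans_lt ENNReal.one_lt_top))]
  refine setIntegral_congr_fun measurableSet_Ioi fun r hr => ?_
  have hr' : (0:ℝ) < r := hr
  have hRnn : 0 ≤ auxR (n+1) r := by
    unfold auxR
    have := Gamma_pos_of_pos (show (0:ℝ) < ((n+1:ℕ):ℝ)/2 by positivity)
    positivity
  have hTnn : 0 ≤ auxT (n+1) t := by
    unfold auxT
    have e1 : ((n + 1 : ℕ):ℝ) - 1 = n := by push_cast; ring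
    have hnp : (0:ℝ) < n := by exact_mod_cast hn
    rw [e1]
    have g1 := Gamma_pos_of_pos (show (0:ℝ) < 1/2 by positivity)
    have g2 := Gamma_pos_of_pos (show (0:ℝ) < (n:ℝ)/2 by positivity)
    have g3 := Gamma_pos_of_pos (show (0:ℝ) < 1/2 + (n:ℝ)/2 by positivity)
    have hsn : 0 ≤ Real.sin (π * t) := Real.sin_nonneg_of_nonneg_of_le_pi
      (mul_nonneg pi_pos.le ht.1) (by nlinarith [ht.2, pi_pos])
    positivity
  have hfRr : fR r = auxR (n+1) r := by rw [hfR]; simp only [hr', if_true]; rfl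
  have hfTt : fT₁ t = auxT (n+1) t := by rw [hfT₁]; rfl
  have hut : u t r = A (r, r * Real.cos (π * t)) := by
    rw [hu]; simp only [A]; congr 4; ring
  try simp only
  rw [ENNReal.toReal_mul, ENNReal.toReal_ofReal (mul_nonneg hRnn hTnn), hfRr, hfTt, hut]
  simp only [Φ]
  rw [← integral_toReal (by fun_prop) (Filter.Eventually.of_forall fun w =>
    ENNReal.mul_lt_top ((hJ1 _).trans_lt ENNReal.one_lt_top) ENNReal.ofReal_lt_top)]
  rw [← integral_const_mul]
  refine integral_congr_ae (Filter.Eventually.of_forall fun w => ?_)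
  simp only [ENNReal.toReal_mul, ENNReal.toReal_ofReal (hfWnn w), hiFun, J]
  rw [mul_assoc ‖b‖ r]
  ring
end
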